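/- Fix T > 0. As N → ∞, the online actor-critic iterates converge uniformly on [0,T] (after time-rescaling t ↦ ⌊Nt⌋) to the solution of the limit ODE system: E[ sup_{t∈[0,T]} ( ‖θ_{⌊Nt⌋} − θ̄_t‖ + ‖Q_{⌊Nt⌋} − Q̄_t‖ ) ] → 0, where (Q̄_t, θ̄_t) is the unique solution of dQ̄_t/dt(x,a) = α π^{g_{θ̄_t}}(x,a)( r(x,a) + γ Σ_{z,a''} Q̄_t(z,a'') g_{θ̄_t}(z,a'') p(z|x,a) − Q̄_t(x,a) ) and dθ̄_t/dt(x,a) = ζ_t σ_μ^{f_{θ̄_t}}(x,a)( Q̄_t(x,a) − Σ_{a'} Q̄_t(x,a') f_{θ̄_t}(x,a') ), with initial condition (Q̄_0, θ̄_0) = (Q_0, θ_0). -/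

import Mathlib

open MeasureTheory Filter Set
open scoped Classical

noncomputable section

def softmaxPol {X A : Type*} [Fintype A] (θ : X → A → ℝ) (x : X) (a : A) : ℝ :=
  Real.exp (θ x a) / ∑ a', Real.exp (θ x a')

def explorePol {X A : Type*} [Fintype A] (η : ℝ) (θ : X → A → ℝ) (x : X) (a : A) : ℝ :=
  η / (Fintype.card A : ℝ) + (1 - η) * softmaxPol θ x a

def zetaN (N k : ℕ) : ℝ := (1 + (k : ℝ) / (N : ℝ))⁻¹

def etaN (N k : ℕ) : ℝ := (1 + (Real.log ((k : ℝ) / (N : ℝ) + 1)) ^ 2)⁻¹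

def zetaT (t : ℝ) : ℝ := (1 + t)⁻¹

def etaT (t : ℝ) : ℝ := (1 + (Real.log (t + 1)) ^ 2)⁻¹

def IsPolicy {X A : Type*} [Fintype A] (f : X → A → ℝ) : Prop :=
  (∀ x a, 0 ≤ f x a) ∧ ∀ x, ∑ a, f x a = 1

def ptilde {X A : Type*} (γ : ℝ) (p : X → A → X → ℝ) (μ : X → ℝ)
    (x : X) (a : A) (x' : X) : ℝ :=
  γ * p x a x' + (1 - γ) * μ x'

def actorKer {X A : Type*} (γ : ℝ) (p : X → A → X → ℝ) (μ : X → ℝ) (f : X → A → ℝ) :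
    X × A → X × A → ℝ :=
  fun ξ ξ' => ptilde γ p μ ξ.1 ξ.2 ξ'.1 * f ξ'.1 ξ'.2

def criticKer {X A : Type*} (p : X → A → X → ℝ) (g : X → A → ℝ) :
    X × A → X × A → ℝ :=
  fun ξ ξ' => p ξ.1 ξ.2 ξ'.1 * g ξ'.1 ξ'.2

def kpow {S : Type*} [Fintype S] [DecidableEq S] (K : S → S → ℝ) : ℕ → S → S → ℝ
  | 0 => fun ξ ξ' => if ξ = ξ' then 1 else 0
  | n + 1 => fun ξ ξ' => ∑ y, K ξ y * kpow K n y ξ'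

def IsStationaryDist {S : Type*} [Fintype S] (K : S → S → ℝ) (d : S → ℝ) : Prop :=
  (∀ ξ, 0 ≤ d ξ) ∧ (∑ ξ, d ξ = 1) ∧ ∀ ξ', d ξ' = ∑ ξ, d ξ * K ξ ξ'

def pathSum {X A : Type*} [Fintype X] [Fintype A] [DecidableEq X]
    (p : X → A → X → ℝ) : ℕ → X → A → X → ℝ
  | 0 => fun x _ x' => if x = x' then 1 else 0
  | 1 => fun x a x' => p x a x'
  | n + 2 => fun x a x' => ∑ x₁ : X, ∑ a₁ : A, p x a x₁ * pathSum p (n + 1) x₁ a₁ x'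

theorem integral_sq_sum_martingaleDiff_le {Ω : Type*} {mΩ : MeasurableSpace Ω}
    (P : Measure Ω) [IsProbabilityMeasure P] (F : Filtration ℕ mΩ) (d : ℕ → Ω → ℝ) (C : ℝ)
    (hd : ∀ k, Measurable[F (k + 1)] (d k)) (n : ℕ)
    (hC : ∀ k < n, ∀ ω, |d k ω| ≤ C) (h0 : ∀ k < n, P[d k | F k] =ᵐ[P] 0) :
    ∫ ω, (∑ k ∈ Finset.range n, d k ω) ^ 2 ∂P ≤ n * C ^ 2 := by
  induction n with
  | zero => simp
  | succ n ih =>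
    have ih' := ih (fun k hk => hC k (by omega)) (fun k hk => h0 k (by omega))
    set S : Ω → ℝ := fun ω => ∑ k ∈ Finset.range n, d k ω with hS
    have hdm : Measurable (d n) := (hd n).mono (F.le _) le_rfl
    have hSF : Measurable[F n] S := by
      refine Finset.measurable_fun_sum _ fun k hk => ?_
      exact (hd k).mono (F.mono (by have := Finset.mem_range.1 hk; omega)) le_rfl
    have hSm : Measurable S := hSF.mono (F.le _) le_rfl
    have hSb : ∀ ω, |S ω| ≤ n * C := fun ω => by
      refine (Finset.abs_sum_le_sum_abs _ _).trans ?_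
      refine (Finset.sum_le_card_nsmul _ _ C fun k hk => hC k ?_ ω).trans ?_
      · have := Finset.mem_range.1 hk; omega
      · simp
    have hdb : ∀ ω, |d n ω| ≤ C := hC n (by omega)
    have hdi : Integrable (d n) P :=
      Integrable.of_bound hdm.aestronglyMeasurable C (ae_of_all _ hdb)
    have hSd : Integrable (S * d n) P := by
      refine Integrable.of_bound (hSm.mul hdm).aestronglyMeasurable (n * C * C)
        (ae_of_all _ fun ω => ?_)
      rw [Pi.mul_apply, Real.norm_eq_abs, abs_mul]
      exact mul_le_mul (hSb ω) (hdb ω) (abs_nonneg _) ((abs_nonneg _).trans (hSb ω))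
    have hSS : Integrable (fun ω => S ω ^ 2) P := by
      refine Integrable.of_bound (hSm.pow_const 2).aestronglyMeasurable ((n * C) ^ 2)
        (ae_of_all _ fun ω => ?_)
      rw [Real.norm_eq_abs, abs_pow]
      exact pow_le_pow_left₀ (abs_nonneg _) (hSb ω) 2
    have hdsq : ∀ ω, d n ω ^ 2 ≤ C ^ 2 := fun ω => by
      rw [← sq_abs]; exact pow_le_pow_left₀ (abs_nonneg _) (hdb ω) 2
    have hdd : Integrable (fun ω => d n ω ^ 2) P := by
      refine Integrable.of_bound (hdm.pow_const 2).aestronglyMeasurable (C ^ 2)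
        (ae_of_all _ fun ω => ?_)
      rw [Real.norm_eq_abs, abs_of_nonneg (sq_nonneg _)]
      exact hdsq ω
    have hcross : ∫ ω, (S * d n) ω ∂P = 0 := by
      rw [← integral_condExp (F.le n)]
      refine integral_eq_zero_of_ae ?_
      filter_upwards [condExp_mul_of_stronglyMeasurable_left (μ := P) hSF.stronglyMeasurable
        hSd hdi, h0 n (by omega)] with ω h1 h2
      rw [h1, Pi.mul_apply, h2]; simp
    have hexp : ∀ ω, (∑ k ∈ Finset.range (n + 1), d k ω) ^ 2
        = S ω ^ 2 + 2 * (S * d n) ω + d n ω ^ 2 := fun ω => by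
      rw [Finset.sum_range_succ]; simp only [hS, Pi.mul_apply]; ring
    simp_rw [hexp]
    rw [integral_add (f := fun ω => S ω ^ 2 + 2 * (S * d n) ω) (hSS.add (hSd.const_mul 2)) hdd,
      integral_add hSS (hSd.const_mul 2),
      integral_const_mul, hcross]
    have : ∫ ω, d n ω ^ 2 ∂P ≤ C ^ 2 := by
      have := integral_mono hdd (integrable_const (C ^ 2)) hdsq
      simpa using this
    push_cast
    linarith

/-- A matrix `1 - K + 𝟙 πᵀ` built from an ergodic kernel and its stationary law is invertible, so
the Poisson equation has a solution depending continuously on the parameter. -/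
theorem exists_continuous_poisson {E S : Type*} [TopologicalSpace E] [Fintype S] [Nonempty S]
    [DecidableEq S] (K : E → S → S → ℝ) (π : E → S → ℝ) (h : E → S → ℝ)
    (hK : ∀ s s', Continuous fun e => K e s s') (hπ : ∀ s, Continuous fun e => π e s)
    (hh : ∀ s, Continuous fun e => h e s) (hK1 : ∀ e s, ∑ s', K e s s' = 1)
    (hst : ∀ e, IsStationaryDist (K e) (π e))
    (herg : ∀ e, ∃ n, 0 < n ∧ ∀ s s', 0 < kpow (K e) n s s') :
    ∃ w : E → S → ℝ, (∀ s, Continuous fun e => w e s) ∧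
      ∀ e s, h e s - ∑ s', π e s' * h e s' = w e s - ∑ s', K e s s' * w e s' := by
  set M : E → Matrix S S ℝ := fun e => Matrix.of fun s s' =>
    (if s = s' then 1 else 0) - K e s s' + π e s' with hM
  set g : E → S → ℝ := fun e s => h e s - ∑ s', π e s' * h e s' with hg
  have hMv : ∀ e (v : S → ℝ) s, (M e).mulVec v s
      = v s - ∑ s', K e s s' * v s' + ∑ s', π e s' * v s' := by
    intro e v s
    simp [hM, Matrix.mulVec, dotProduct, add_mul, sub_mul, Finset.sum_add_distrib,
      Finset.sum_sub_distrib]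
  have hπK : ∀ e (v : S → ℝ), ∑ s, π e s * ∑ s', K e s s' * v s' = ∑ s', π e s' * v s' := by
    intro e v
    simp_rw [Finset.mul_sum]
    rw [Finset.sum_comm]
    refine Finset.sum_congr rfl fun s' _ => ?_
    rw [(hst e).2.2 s', Finset.sum_mul]
    exact Finset.sum_congr rfl fun s _ => by ring
  have hπM : ∀ e (v : S → ℝ), ∑ s, π e s * (M e).mulVec v s = ∑ s, π e s * v s := by
    intro e v
    simp_rw [hMv, mul_add, mul_sub, Finset.sum_add_distrib, Finset.sum_sub_distrib]
    rw [hπK, ← Finset.sum_mul, (hst e).2.1]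
    ring
  have hdet : ∀ e, (M e).det ≠ 0 := by
    intro e hzero
    obtain ⟨v, hv, hv0⟩ := Matrix.exists_mulVec_eq_zero_iff.2 hzero
    have hπv : ∑ s, π e s * v s = 0 := by
      rw [← hπM, hv0]; simp
    have hKv : ∀ s, ∑ s', K e s s' * v s' = v s := by
      intro s
      have := hMv e v s
      rw [hv0, hπv] at this
      simp only [Pi.zero_apply] at this
      linarith
    have hpow : ∀ (u : S → ℝ), (∀ s, ∑ s', K e s s' * u s' = u s) →
        ∀ n s, ∑ s', kpow (K e) n s s' * u s' = u s := by
      intro u hu n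
      induction n with
      | zero => intro s; simp [kpow]
      | succ n ih =>
        intro s
        simp only [kpow, Finset.sum_mul]
        rw [Finset.sum_comm]
        simp_rw [mul_assoc, ← Finset.mul_sum, ih]
        exact hu s
    obtain ⟨n, -, hn⟩ := herg e
    obtain ⟨m, hm⟩ := Finite.exists_max v
    have hconst : ∀ s, v s = v m := by
      have hsum : ∑ s', kpow (K e) n m s' * (v m - v s') = 0 := by
        simp_rw [mul_sub, Finset.sum_sub_distrib]
        rw [hpow v hKv, ← Finset.sum_mul]
        have := hpow (fun _ => 1) (by simpa using hK1 e) n m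
        simp only [mul_one] at this
        rw [this]; ring
      intro s
      have := (Finset.sum_eq_zero_iff_of_nonneg fun s' _ =>
        mul_nonneg (hn m s').le (sub_nonneg.2 (hm s'))).1 hsum s (Finset.mem_univ _)
      rcases mul_eq_zero.1 this with h' | h'
      · exact absurd h' (hn m s).ne'
      · linarith
    apply hv
    ext s
    have : ∑ s, π e s * v s = v m := by
      simp_rw [hconst, ← Finset.sum_mul, (hst e).2.1, one_mul]
    rw [hconst, ← this, hπv]; rfl
  have hMc : Continuous M := by
    refine continuous_matrix fun s s' => ?_
    exact (continuous_const.sub (hK s s')).add (hπ s')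
  have hgc : ∀ s, Continuous fun e => g e s := fun s =>
    (hh s).sub (continuous_finsetSum _ fun s' _ => (hπ s').mul (hh s'))
  refine ⟨fun e => (M e).det⁻¹ • (M e).adjugate.mulVec (g e), fun s => ?_, fun e s => ?_⟩
  · have h1 : Continuous fun e => (M e).adjugate.mulVec (g e) :=
      hMc.matrix_adjugate.matrix_mulVec (continuous_pi hgc)
    exact (hMc.matrix_det.inv₀ hdet).mul ((continuous_apply s).comp h1)
  · set w := (M e).det⁻¹ • (M e).adjugate.mulVec (g e) with hw
    have hMw : (M e).mulVec w = g e := by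
      rw [hw, Matrix.mulVec_smul, Matrix.mulVec_mulVec, Matrix.mul_adjugate, Matrix.smul_mulVec,
        Matrix.one_mulVec, smul_smul, inv_mul_cancel₀ (hdet e), one_smul]
    have hπw : ∑ s, π e s * w s = 0 := by
      rw [← hπM, hMw]
      simp_rw [hg, mul_sub, Finset.sum_sub_distrib]
      rw [← Finset.sum_mul, (hst e).2.1]; ring
    have := hMv e w s
    rw [hMw, hπw, add_zero] at this
    exact this

theorem exists_forall_abs_le_of_isCompact {E ι : Type*} [TopologicalSpace E] [Fintype ι]
    {D : Set E} (hD : IsCompact D) (u : ι → E → ℝ) (hu : ∀ i, Continuous (u i)) :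
    ∃ C, 0 ≤ C ∧ ∀ i, ∀ e ∈ D, |u i e| ≤ C := by
  obtain ⟨C, hC⟩ := hD.exists_bound_of_continuousOn (f := fun e i => u i e)
    (continuous_pi hu).continuousOn
  exact ⟨max C 0, le_max_right _ _, fun i e he =>
    ((norm_le_pi_norm (fun i => u i e) i).trans (hC e he)).trans (le_max_left _ _)⟩

theorem exists_forall_abs_sub_le_of_isCompact {E ι : Type*} [PseudoMetricSpace E] [Fintype ι]
    {D : Set E} (hD : IsCompact D) (u : ι → E → ℝ) (hu : ∀ i, Continuous (u i))
    {ε : ℝ} (hε : 0 < ε) :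
    ∃ δ > 0, ∀ i, ∀ e ∈ D, ∀ e' ∈ D, dist e e' ≤ δ → |u i e - u i e'| ≤ ε := by
  obtain ⟨δ, hδ, h⟩ := Metric.uniformContinuousOn_iff_le.1
    (hD.uniformContinuousOn_of_continuous (f := fun e i => u i e)
      (continuous_pi hu).continuousOn) ε hε
  refine ⟨δ, hδ, fun i e he e' he' hd => ?_⟩
  have := (dist_le_pi_dist (fun i => u i e) (fun i => u i e') i).trans (h e he e' he' hd)
  rwa [Real.dist_eq] at this

theorem measurable_apply_of_countable {Ω E S : Type*} {m : MeasurableSpace Ω}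
    [MeasurableSpace E] [MeasurableSpace S] [Countable S] [MeasurableSingletonClass S]
    {f : E → S → ℝ} (hf : ∀ s, Measurable fun e => f e s) {e : Ω → E} {s : Ω → S}
    (he : Measurable[m] e) (hs : Measurable[m] s) : Measurable[m] fun ω => f (e ω) (s ω) := by
  have h : Measurable fun x : E × S => f x.1 x.2 := measurable_from_prod_countable_left hf
  exact h.comp (he.prodMk hs)

theorem sum_sub_average_eq {S : Type*} [Fintype S] [DecidableEq S] (K b : ℕ → S → S → ℝ)
    (c : ℕ → ℝ) (w : ℕ → S → ℝ) (ξ : ℕ → S)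
    (hw : ∀ k s, ∑ s', K k s s' * b k s s' - c k = w k s - ∑ s', K k s s' * w k s') (n : ℕ) :
    ∑ k ∈ Finset.range n, (b k (ξ k) (ξ (k + 1)) - c k) =
      ∑ k ∈ Finset.range n, ∑ s, (b k (ξ k) s + w k s) *
        ((if ξ (k + 1) = s then 1 else 0) - K (k + 1) (ξ k) s) +
      (w 0 (ξ 0) - w n (ξ n)) +
      ∑ k ∈ Finset.range n, ((w (k + 1) (ξ (k + 1)) - w k (ξ (k + 1))) +
        ∑ s, (K (k + 1) (ξ k) s - K k (ξ k) s) * (b k (ξ k) s + w k s)) := by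
  induction n with
  | zero => simp
  | succ n ih =>
    rw [Finset.sum_range_succ, ih, Finset.sum_range_succ, Finset.sum_range_succ]
    have h := hw n (ξ n)
    simp only [mul_sub, sub_mul, mul_add, add_mul, Finset.sum_add_distrib,
      Finset.sum_sub_distrib, mul_ite, mul_one, mul_zero, Finset.sum_ite_eq, Finset.mem_univ,
      if_true] at h ⊢
    have h1 : ∀ v : S → ℝ, ∑ s, v s * K (n + 1) (ξ n) s = ∑ s, K (n + 1) (ξ n) s * v s :=
      fun v => Finset.sum_congr rfl fun s _ => mul_comm _ _
    rw [h1, h1]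
    linarith

theorem condExp_sum_mul_indicator_sub_eq_zero {Ω S : Type*} {m mΩ : MeasurableSpace Ω}
    (P : Measure Ω) [IsProbabilityMeasure P] [Fintype S] [DecidableEq S] [MeasurableSpace S]
    [MeasurableSingletonClass S] (hm : m ≤ mΩ) (ξ : Ω → S)
    (hξ : Measurable ξ) (c κ : S → Ω → ℝ) (C : ℝ) (hc : ∀ s, Measurable[m] (c s))
    (hcC : ∀ s ω, |c s ω| ≤ C) (hκ : ∀ s, Measurable (κ s))
    (hκC : ∀ s ω, |κ s ω| ≤ C)
    (h : ∀ s, P[fun ω => if ξ ω = s then (1 : ℝ) else 0 | m] =ᵐ[P] κ s) :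
    P[fun ω => ∑ s, c s ω * ((if ξ ω = s then 1 else 0) - κ s ω) | m] =ᵐ[P] 0 := by
  set I : S → Ω → ℝ := fun s ω => if ξ ω = s then (1 : ℝ) else 0 with hI
  have hIm : ∀ s, Measurable (I s) := fun s =>
    Measurable.ite (hξ (measurableSet_singleton s)) measurable_const measurable_const
  have hIb : ∀ s ω, |I s ω| ≤ 1 := fun s ω => by
    simp only [hI]; split_ifs <;> simp
  have hIi : ∀ s, Integrable (I s) P := fun s =>
    Integrable.of_bound (hIm s).aestronglyMeasurable 1 (ae_of_all _ (hIb s))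
  have hκi : ∀ s, Integrable (κ s) P := fun s =>
    Integrable.of_bound (hκ s).aestronglyMeasurable C (ae_of_all _ (hκC s))
  have hci : ∀ s, Integrable (c s * (I s - κ s)) P := fun s => by
    refine Integrable.of_bound (((hc s).mono hm le_rfl).mul
      ((hIm s).sub (hκ s))).aestronglyMeasurable (C * (1 + C)) (ae_of_all _ fun ω => ?_)
    rw [Pi.mul_apply, Real.norm_eq_abs, abs_mul]
    refine mul_le_mul (hcC s ω) ?_ (abs_nonneg _) ((abs_nonneg _).trans (hcC s ω))
    exact (abs_sub _ _).trans (add_le_add (hIb s ω) (hκC s ω))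
  have hterm : ∀ s, P[c s * (I s - κ s) | m] =ᵐ[P] 0 := fun s => by
    have h1 := condExp_mul_of_stronglyMeasurable_left (μ := P) (hc s).stronglyMeasurable
      (hci s) ((hIi s).sub (hκi s))
    have h2 := condExp_sub (hIi s) (hκi s) m
    have h3 : P[κ s | m] =ᵐ[P] P[I s | m] :=
      (condExp_congr_ae (h s).symm).trans (condExp_condExp_of_le le_rfl hm)
    filter_upwards [h1, h2, h3] with ω e1 e2 e3
    rw [e1, Pi.mul_apply, e2, Pi.sub_apply, e3]; simp
  have hsum : (fun ω => ∑ s, c s ω * ((if ξ ω = s then 1 else 0) - κ s ω))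
      = ∑ s, c s * (I s - κ s) := by
    ext ω; simp [hI]
  rw [hsum]
  refine (condExp_finsetSum (fun s _ => hci s) m).trans ?_
  have hall : ∀ᵐ ω ∂P, ∀ s, P[c s * (I s - κ s) | m] ω = 0 := ae_all_iff.2 hterm
  filter_upwards [hall] with ω hω
  rw [Finset.sum_apply]
  exact Finset.sum_eq_zero fun s _ => hω s

theorem inv_mul_abs_le_add_sq {N ε : ℝ} (hN : 0 < N) (hε : 0 < ε) (a : ℝ) :
    N⁻¹ * |a| ≤ ε + (4 * ε * N ^ 2)⁻¹ * a ^ 2 := by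
  have h1 : (4 * ε * N ^ 2)⁻¹ * a ^ 2 = (N⁻¹ * |a|) ^ 2 / (4 * ε) := by
    rw [mul_pow, sq_abs]; field_simp
  rw [h1, ← sub_le_iff_le_add', le_div_iff₀ (by positivity)]
  nlinarith [sq_nonneg (N⁻¹ * |a| - 2 * ε)]

theorem eventually_div_natCast_le (c : ℝ) {ε : ℝ} (hε : 0 < ε) :
    ∀ᶠ N : ℕ in atTop, 0 < (N : ℝ) ∧ c / N ≤ ε := by
  have h1 := (tendsto_const_div_atTop_nhds_zero_nat c).eventually (ge_mem_nhds hε)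
  filter_upwards [h1, eventually_gt_atTop 0] with N h2 h3
  exact ⟨by exact_mod_cast h3, h2⟩

theorem eventually_integral_abs_average_le {Ω E S : Type*} {mΩ : MeasurableSpace Ω}
    (P : Measure Ω) [IsProbabilityMeasure P] [PseudoMetricSpace E] [MeasurableSpace E]
    [BorelSpace E] [Fintype S] [DecidableEq S] [MeasurableSpace S]
    [MeasurableSingletonClass S] (K b : E → S → S → ℝ) (c : E → ℝ) (w : E → S → ℝ)
    (hK : ∀ s s', Continuous fun e => K e s s') (hb : ∀ s s', Continuous fun e => b e s s')
    (hwc : ∀ s, Continuous fun e => w e s)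
    (hw : ∀ e s, ∑ s', K e s s' * b e s s' - c e = w e s - ∑ s', K e s s' * w e s')
    (F : ℕ → Filtration ℕ mΩ) (e : ℕ → ℕ → Ω → E) (ξ : ℕ → ℕ → Ω → S)
    (hem : ∀ N k, Measurable[F N k] (e N k)) (hξm : ∀ N k, Measurable[F N k] (ξ N k))
    (hcond : ∀ N k s, P[fun ω => if ξ N (k + 1) ω = s then (1 : ℝ) else 0 | F N k] =ᵐ[P]
      fun ω => K (e N (k + 1) ω) (ξ N k ω) s)
    {D : Set E} (hD : IsCompact D) {T : ℝ} (hT : 0 < T)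
    (heD : ∀ᶠ N : ℕ in atTop, ∀ k : ℕ, (k : ℝ) ≤ N * T → ∀ ω, e N k ω ∈ D)
    (hstep : ∀ δ > 0, ∀ᶠ N : ℕ in atTop, ∀ k : ℕ, ((k + 1 : ℕ) : ℝ) ≤ N * T →
      ∀ ω, dist (e N (k + 1) ω) (e N k ω) ≤ δ) {ε : ℝ} (hε : 0 < ε) :
    ∀ᶠ N : ℕ in atTop, ∀ n : ℕ, (n : ℝ) ≤ N * T →
      ∫ ω, |(N : ℝ)⁻¹ * ∑ k ∈ Finset.range n,
        (b (e N k ω) (ξ N k ω) (ξ N (k + 1) ω) - c (e N k ω))| ∂P ≤ ε := by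
  obtain ⟨C₁, hC₁, hC₁'⟩ := exists_forall_abs_le_of_isCompact hD
    (fun (i : S × S) e => K e i.1 i.2) fun i => hK _ _
  obtain ⟨C₂, hC₂, hC₂'⟩ := exists_forall_abs_le_of_isCompact hD
    (fun (i : S × S) e => b e i.1 i.2) fun i => hb _ _
  obtain ⟨C₃, hC₃, hC₃'⟩ := exists_forall_abs_le_of_isCompact hD (fun i e => w e i) hwc
  set m : ℝ := (Fintype.card S : ℝ) with hm
  have hm0 : 0 ≤ m := Nat.cast_nonneg _
  set Cd : ℝ := m * ((C₂ + C₃) * (1 + C₁)) with hCd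
  set ε₂ : ℝ := ε / (4 * T * (1 + m * (C₂ + C₃))) with hε₂
  have hε₂0 : 0 < ε₂ := by positivity
  have hε₂T : T * (ε₂ * (1 + m * (C₂ + C₃))) = ε / 4 := by
    have : 1 + m * (C₂ + C₃) ≠ 0 := by positivity
    rw [hε₂]; field_simp
  obtain ⟨δ₁, hδ₁, hδ₁'⟩ := exists_forall_abs_sub_le_of_isCompact hD
    (fun (i : S × S) e => K e i.1 i.2) (fun i => hK _ _) hε₂0
  obtain ⟨δ₂, hδ₂, hδ₂'⟩ := exists_forall_abs_sub_le_of_isCompact hD (fun i e => w e i) hwc hε₂0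
  have hε4 : 0 < ε / 4 := by positivity
  filter_upwards [heD, hstep _ (lt_min hδ₁ hδ₂), eventually_div_natCast_le (T * Cd ^ 2 / ε) hε4,
    eventually_div_natCast_le (2 * C₃) hε4] with N hND hNs hN1 hN2 n hn
  obtain ⟨hN, hN1⟩ := hN1
  have hN2 := hN2.2
  have hkD : ∀ k ≤ n, ∀ ω, e N k ω ∈ D := fun k hk ω =>
    hND k (le_trans (by exact_mod_cast hk) hn) ω
  have hks : ∀ k < n, ∀ ω, dist (e N (k + 1) ω) (e N k ω) ≤ min δ₁ δ₂ := fun k hk ω =>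
    hNs k (le_trans (by exact_mod_cast hk) hn) ω
  set d : ℕ → Ω → ℝ := fun k ω => ∑ s, (b (e N k ω) (ξ N k ω) s + w (e N k ω) s) *
    ((if ξ N (k + 1) ω = s then 1 else 0) - K (e N (k + 1) ω) (ξ N k ω) s) with hd
  have hcm : ∀ k s, Measurable[F N k] fun ω => b (e N k ω) (ξ N k ω) s + w (e N k ω) s :=
    fun k s => (measurable_apply_of_countable (f := fun e s' => b e s' s)
      (fun s' => (hb s' s).measurable) (hem N k) (hξm N k)).add
      ((hwc s).measurable.comp (hem N k))
  have hκm : ∀ k s, Measurable[F N (k + 1)] fun ω => K (e N (k + 1) ω) (ξ N k ω) s :=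
    fun k s => measurable_apply_of_countable (f := fun e s' => K e s' s)
      (fun s' => (hK s' s).measurable) (hem N (k + 1))
      ((hξm N k).mono ((F N).mono (Nat.le_succ k)) le_rfl)
  have hcC : ∀ k < n, ∀ s ω, |b (e N k ω) (ξ N k ω) s + w (e N k ω) s| ≤ C₂ + C₃ :=
    fun k hk s ω => (abs_add_le _ _).trans (add_le_add
      (hC₂' (_, _) _ (hkD k hk.le ω)) (hC₃' _ _ (hkD k hk.le ω)))
  have hκC : ∀ k < n, ∀ s ω, |K (e N (k + 1) ω) (ξ N k ω) s| ≤ C₁ :=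
    fun k hk s ω => hC₁' (_, _) _ (hkD _ hk ω)
  have hdm : ∀ k, Measurable[F N (k + 1)] (d k) := fun k => by
    refine Finset.measurable_fun_sum _ fun s _ => ?_
    refine ((hcm k s).mono ((F N).mono (Nat.le_succ k)) le_rfl).mul (Measurable.sub ?_ (hκm k s))
    exact Measurable.ite (hξm N (k + 1) (measurableSet_singleton s)) measurable_const
      measurable_const
  have hdC : ∀ k < n, ∀ ω, |d k ω| ≤ Cd := fun k hk ω => by
    refine (Finset.abs_sum_le_sum_abs _ _).trans ?_
    refine (Finset.sum_le_card_nsmul _ _ ((C₂ + C₃) * (1 + C₁)) fun s _ => ?_).trans ?_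
    · rw [abs_mul]
      refine mul_le_mul (hcC k hk s ω) ?_ (abs_nonneg _) (by positivity)
      refine (abs_sub _ _).trans (add_le_add ?_ (hκC k hk s ω))
      split_ifs <;> simp
    · simp [hCd, hm]
  have hd0 : ∀ k < n, P[d k | F N k] =ᵐ[P] 0 := fun k hk =>
    condExp_sum_mul_indicator_sub_eq_zero P ((F N).le k) (ξ N (k + 1))
      ((hξm N (k + 1)).mono ((F N).le _) le_rfl) _ _ (max (C₂ + C₃) C₁) (hcm k)
      (fun s ω => (hcC k hk s ω).trans (le_max_left _ _))
      (fun s => (hκm k s).mono ((F N).le _) le_rfl)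
      (fun s ω => (hκC k hk s ω).trans (le_max_right _ _)) (hcond N k)
  have hsq := integral_sq_sum_martingaleDiff_le P (F N) d Cd hdm n hdC hd0
  have hpath : ∀ ω, |(N : ℝ)⁻¹ * ∑ k ∈ Finset.range n,
        (b (e N k ω) (ξ N k ω) (ξ N (k + 1) ω) - c (e N k ω))| ≤
      (4 * (ε / 4) * (N : ℝ) ^ 2)⁻¹ * (∑ k ∈ Finset.range n, d k ω) ^ 2 + 3 * (ε / 4) := by
    intro ω
    rw [sum_sub_average_eq (fun k => K (e N k ω)) (fun k => b (e N k ω)) (fun k => c (e N k ω))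
      (fun k => w (e N k ω)) (fun k => ξ N k ω) (fun k s => hw _ s) n, abs_mul,
      abs_of_pos (inv_pos.2 hN)]
    have h1 := inv_mul_abs_le_add_sq hN hε4 (∑ k ∈ Finset.range n, d k ω)
    have h2 : |w (e N 0 ω) (ξ N 0 ω) - w (e N n ω) (ξ N n ω)| ≤ 2 * C₃ := by
      refine (abs_sub _ _).trans ?_
      linarith [hC₃' (ξ N 0 ω) _ (hkD 0 (Nat.zero_le _) ω), hC₃' (ξ N n ω) _ (hkD n le_rfl ω)]
    have h3 : |∑ k ∈ Finset.range n,
        ((w (e N (k + 1) ω) (ξ N (k + 1) ω) - w (e N k ω) (ξ N (k + 1) ω)) +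
        ∑ s, (K (e N (k + 1) ω) (ξ N k ω) s - K (e N k ω) (ξ N k ω) s) *
          (b (e N k ω) (ξ N k ω) s + w (e N k ω) s))| ≤
        n * (ε₂ * (1 + m * (C₂ + C₃))) := by
      refine (Finset.abs_sum_le_sum_abs _ _).trans ?_
      refine (Finset.sum_le_card_nsmul _ _ (ε₂ * (1 + m * (C₂ + C₃))) fun k hk => ?_).trans ?_
      · have hk := Finset.mem_range.1 hk
        have hdist := hks k hk ω
        refine (abs_add_le _ _).trans ?_
        rw [mul_add, mul_one]
        refine add_le_add (hδ₂' _ _ (hkD _ hk ω) _ (hkD _ hk.le ω)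
          (hdist.trans (min_le_right _ _))) ?_
        refine (Finset.abs_sum_le_sum_abs _ _).trans ?_
        refine (Finset.sum_le_card_nsmul _ _ (ε₂ * (C₂ + C₃)) fun s _ => ?_).trans ?_
        · rw [abs_mul]
          exact mul_le_mul (hδ₁' (_, _) _ (hkD _ hk ω) _ (hkD _ hk.le ω)
            (hdist.trans (min_le_left _ _))) (hcC k hk s ω) (abs_nonneg _) hε₂0.le
        · rw [nsmul_eq_mul, Finset.card_univ, ← hm]; apply le_of_eq; ring
      · simp
    have h4 : (N : ℝ)⁻¹ * (2 * C₃) ≤ ε / 4 := by rwa [inv_mul_eq_div]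
    have h5 : (N : ℝ)⁻¹ * (n * (ε₂ * (1 + m * (C₂ + C₃)))) ≤ ε / 4 := by
      rw [← hε₂T, inv_mul_le_iff₀ hN]
      have h0 : 0 ≤ ε₂ * (1 + m * (C₂ + C₃)) := by positivity
      exact (mul_le_mul_of_nonneg_right hn h0).trans_eq (mul_assoc _ _ _)
    refine (mul_le_mul_of_nonneg_left ((abs_add_le _ _).trans (add_le_add
      ((abs_add_le _ _).trans (add_le_add le_rfl h2)) h3)) (inv_pos.2 hN).le).trans ?_
    rw [mul_add, mul_add]
    linarith
  have hSm : Measurable fun ω => ∑ k ∈ Finset.range n, d k ω :=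
    Finset.measurable_fun_sum _ fun k _ => (hdm k).mono ((F N).le _) le_rfl
  have hSi : Integrable (fun ω => (∑ k ∈ Finset.range n, d k ω) ^ 2) P := by
    refine Integrable.of_bound (hSm.pow_const 2).aestronglyMeasurable ((n * Cd) ^ 2)
      (ae_of_all _ fun ω => ?_)
    rw [Real.norm_eq_abs, abs_pow]
    refine pow_le_pow_left₀ (abs_nonneg _) ((Finset.abs_sum_le_sum_abs _ _).trans ?_) 2
    refine (Finset.sum_le_card_nsmul _ _ Cd fun k hk =>
      hdC k (Finset.mem_range.1 hk) ω).trans ?_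
    simp
  refine (integral_mono_of_nonneg (ae_of_all _ fun ω => abs_nonneg _)
    ((hSi.const_mul _).add (integrable_const _)) (ae_of_all _ hpath)).trans ?_
  rw [integral_add' (hSi.const_mul _) (integrable_const _), integral_const_mul]
  have h6 : (4 * (ε / 4) * (N : ℝ) ^ 2)⁻¹ * ∫ ω, (∑ k ∈ Finset.range n, d k ω) ^ 2 ∂P
      ≤ ε / 4 := by
    refine le_trans ?_ hN1
    refine (mul_le_mul_of_nonneg_left (hsq.trans (mul_le_mul_of_nonneg_right hn
      (sq_nonneg _))) (by positivity)).trans (le_of_eq ?_)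
    field_simp
  simp only [integral_const, probReal_univ, smul_eq_mul, one_mul]
  linarith

/-- A sequence with small increments is dominated uniformly by its time average. -/
theorem sq_le_mul_sum_abs {M : ℕ → ℝ} {c : ℝ} (hc : 0 ≤ c) (h0 : M 0 = 0) (n : ℕ)
    (h : ∀ k < n, |M (k + 1) - M k| ≤ c) :
    M n ^ 2 ≤ 2 * c * ∑ k ∈ Finset.range (n + 1), |M k| := by
  suffices hs : M n ^ 2 ≤ 2 * c * ∑ k ∈ Finset.range (n + 1), |M k| - c * |M n| by
    have := mul_nonneg hc (abs_nonneg (M n))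
    linarith
  induction n with
  | zero => simp [h0]
  | succ n ih =>
    have ih' := ih fun k hk => h k (by omega)
    rw [Finset.sum_range_succ]
    have h1 : M (n + 1) ^ 2 - M n ^ 2 ≤ c * (|M (n + 1)| + |M n|) := by
      rw [sq_sub_sq, mul_comm]
      refine (le_abs_self _).trans ?_
      rw [abs_mul]
      exact mul_le_mul (h n (by omega)) (abs_add_le _ _) (abs_nonneg _) hc
    linarith

theorem eventually_exists_integrable_bound_average {Ω E S : Type*} {mΩ : MeasurableSpace Ω}
    (P : Measure Ω) [IsProbabilityMeasure P] [PseudoMetricSpace E] [MeasurableSpace E]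
    [BorelSpace E] [Fintype S] [Nonempty S] [DecidableEq S] [MeasurableSpace S]
    [MeasurableSingletonClass S] (K b : E → S → S → ℝ) (π : E → S → ℝ) (c : E → ℝ)
    (hK : ∀ s s', Continuous fun e => K e s s') (hπ : ∀ s, Continuous fun e => π e s)
    (hb : ∀ s s', Continuous fun e => b e s s') (hK1 : ∀ e s, ∑ s', K e s s' = 1)
    (hst : ∀ e, IsStationaryDist (K e) (π e))
    (herg : ∀ e, ∃ n, 0 < n ∧ ∀ s s', 0 < kpow (K e) n s s')
    (hc : ∀ e, c e = ∑ s, π e s * ∑ s', K e s s' * b e s s')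
    (F : ℕ → Filtration ℕ mΩ) (e : ℕ → ℕ → Ω → E) (ξ : ℕ → ℕ → Ω → S)
    (hem : ∀ N k, Measurable[F N k] (e N k)) (hξm : ∀ N k, Measurable[F N k] (ξ N k))
    (hcond : ∀ N k s, P[fun ω => if ξ N (k + 1) ω = s then (1 : ℝ) else 0 | F N k] =ᵐ[P]
      fun ω => K (e N (k + 1) ω) (ξ N k ω) s)
    {D : Set E} (hD : IsCompact D) {T : ℝ} (hT : 0 < T)
    (heD : ∀ᶠ N : ℕ in atTop, ∀ k : ℕ, (k : ℝ) ≤ N * T → ∀ ω, e N k ω ∈ D)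
    (hstep : ∀ δ > 0, ∀ᶠ N : ℕ in atTop, ∀ k : ℕ, ((k + 1 : ℕ) : ℝ) ≤ N * T →
      ∀ ω, dist (e N (k + 1) ω) (e N k ω) ≤ δ) {ε : ℝ} (hε : 0 < ε) :
    ∀ᶠ N : ℕ in atTop, ∃ G : Ω → ℝ, Integrable G P ∧ ∫ ω, G ω ∂P ≤ ε ∧
      ∀ ω, ∀ n : ℕ, (n : ℝ) ≤ N * T → |(N : ℝ)⁻¹ * ∑ k ∈ Finset.range n,
        (b (e N k ω) (ξ N k ω) (ξ N (k + 1) ω) - c (e N k ω))| ≤ G ω := by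
  have hKb : ∀ s, Continuous fun e => ∑ s', K e s s' * b e s s' := fun s =>
    continuous_finsetSum _ fun s' _ => (hK s s').mul (hb s s')
  have hcc : Continuous c := by
    rw [show c = fun e => ∑ s, π e s * ∑ s', K e s s' * b e s s' from funext hc]
    exact continuous_finsetSum _ fun s _ => (hπ s).mul (hKb s)
  obtain ⟨w, hwc, hw⟩ := exists_continuous_poisson K π
    (fun e s => ∑ s', K e s s' * b e s s') hK hπ hKb hK1 hst herg
  obtain ⟨C, hC, hC'⟩ := exists_forall_abs_le_of_isCompact hD
    (fun (i : S × S) e => b e i.1 i.2 - c e) fun i => (hb _ _).sub hcc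
  set ε₁ : ℝ := ε ^ 2 / (2 * (C + 1) * (T + 1)) with hε₁
  have hε₁0 : 0 < ε₁ := by positivity
  filter_upwards [heD, eventually_ge_atTop 1, eventually_integral_abs_average_le P K b c w hK hb
    hwc (fun e s => by rw [hc]; exact hw e s) F e ξ hem hξm hcond hD hT heD hstep hε₁0]
    with N hND hN1 hav
  have hN1 : (1 : ℝ) ≤ N := by exact_mod_cast hN1
  have hN : (0 : ℝ) < N := by linarith
  set M : ℕ → Ω → ℝ := fun n ω => (N : ℝ)⁻¹ * ∑ k ∈ Finset.range n,
        (b (e N k ω) (ξ N k ω) (ξ N (k + 1) ω) - c (e N k ω)) with hM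
  have hinc : ∀ k : ℕ, (k : ℝ) ≤ N * T → ∀ ω, |M (k + 1) ω - M k ω| ≤ C / N := by
    intro k hk ω
    have : M (k + 1) ω - M k ω
        = (N : ℝ)⁻¹ * (b (e N k ω) (ξ N k ω) (ξ N (k + 1) ω) - c (e N k ω)) := by
      simp only [hM, Finset.sum_range_succ]; ring
    rw [this, abs_mul, abs_of_pos (inv_pos.2 hN), inv_mul_eq_div]
    exact div_le_div_of_nonneg_right (hC' (_, _) _ (hND k hk ω)) hN.le
  have hMm : ∀ n, Measurable (M n) := fun n => by
    refine Measurable.const_mul (Finset.measurable_fun_sum _ fun k _ => ?_) _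
    have he := (hem N k).mono ((F N).le k) le_rfl
    refine Measurable.sub ?_ (hcc.measurable.comp he)
    exact measurable_apply_of_countable (f := fun e (s : S × S) => b e s.1 s.2)
      (fun s => (hb s.1 s.2).measurable) he
      (((hξm N k).mono ((F N).le k) le_rfl).prodMk ((hξm N (k + 1)).mono ((F N).le _) le_rfl))
  have hMb : ∀ n : ℕ, (n : ℝ) ≤ N * T → ∀ ω, |M n ω| ≤ n * (C / N) := by
    intro n
    induction n with
    | zero => intro _ ω; simp [hM]
    | succ n ih =>
      intro hn ω
      push_cast at hn
      have h1 := ih (by linarith) ω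
      have h2 := hinc n (by linarith) ω
      have h3 := abs_add_le (M (n + 1) ω - M n ω) (M n ω)
      rw [sub_add_cancel] at h3
      push_cast
      linarith
  set J : ℕ := ⌊(N : ℝ) * T⌋₊ with hJ
  have hJT : (J : ℝ) ≤ N * T := Nat.floor_le (by positivity)
  have hJk : ∀ k ∈ Finset.range (J + 1), (k : ℝ) ≤ N * T := fun k hk =>
    le_trans (by exact_mod_cast Nat.lt_succ_iff.1 (Finset.mem_range.1 hk)) hJT
  have hMi : ∀ k ∈ Finset.range (J + 1), Integrable (fun ω => |M k ω|) P := fun k hk =>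
    (Integrable.of_bound (hMm k).aestronglyMeasurable _ (ae_of_all _ (hMb k (hJk k hk)))).abs
  have hsi : Integrable (fun ω => ∑ k ∈ Finset.range (J + 1), |M k ω|) P :=
    integrable_finsetSum _ hMi
  refine ⟨fun ω => (2 * ε)⁻¹ * (2 * (C / N)) * ∑ k ∈ Finset.range (J + 1), |M k ω| + ε / 2,
    (hsi.const_mul _).add (integrable_const _), ?_, fun ω n hn => ?_⟩
  · rw [integral_add (hsi.const_mul _) (integrable_const _), integral_const_mul,
      integral_finsetSum _ hMi]
    have h1 : ∑ k ∈ Finset.range (J + 1), ∫ ω, |M k ω| ∂P ≤ N * (T + 1) * ε₁ := by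
      refine (Finset.sum_le_card_nsmul _ _ ε₁ fun k hk => hav k (hJk k hk)).trans ?_
      rw [Finset.card_range, nsmul_eq_mul]
      push_cast
      exact mul_le_mul_of_nonneg_right (by linarith) hε₁0.le
    have h2 : (2 * ε)⁻¹ * (2 * (C / N)) * (N * (T + 1) * ε₁) ≤ ε / 2 := by
      have : (2 * ε)⁻¹ * (2 * (C / N)) * (N * (T + 1) * ε₁) = (ε / 2) * (C / (C + 1)) := by
        rw [hε₁]; field_simp
      rw [this]
      exact mul_le_of_le_one_right (by positivity) ((div_le_one (by positivity)).2 (by linarith))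
    have h3 := (mul_le_mul_of_nonneg_left h1
      (show 0 ≤ (2 * ε)⁻¹ * (2 * (C / N)) by positivity)).trans h2
    simp only [integral_const, probReal_univ, smul_eq_mul, one_mul]
    linarith
  · have hnJ : n ≤ J := Nat.le_floor hn
    have h1 := sq_le_mul_sum_abs (M := fun k => M k ω) (by positivity) (by simp [hM]) n
      fun k hk => hinc k (le_trans (by exact_mod_cast hk.le) hn) ω
    have h2 : ∑ k ∈ Finset.range (n + 1), |M k ω| ≤ ∑ k ∈ Finset.range (J + 1), |M k ω| :=
      Finset.sum_le_sum_of_subset_of_nonneg (Finset.range_mono (by omega))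
        fun _ _ _ => abs_nonneg _
    have h3 := inv_mul_abs_le_add_sq one_pos (half_pos hε) (M n ω)
    have h4 : (4 * (ε / 2) * (1 : ℝ) ^ 2)⁻¹ = (2 * ε)⁻¹ := by ring_nf
    rw [h4, inv_one, one_mul] at h3
    have h5 := h1.trans (mul_le_mul_of_nonneg_left h2 (show 0 ≤ 2 * (C / N) by positivity))
    have h6 := mul_le_mul_of_nonneg_left h5 (show 0 ≤ (2 * ε)⁻¹ by positivity)
    rw [← mul_assoc] at h6
    linarith

theorem sum_abs_sub_le_exp_mul {I : Type*} [Fintype I] (y z β β' ρ M : ℕ → I → ℝ)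
    {h L κ τ : ℝ} (G : I → ℝ) (hh : 0 ≤ h) (hL : 0 ≤ L) (hκ : 0 ≤ κ) (n : ℕ) (hn : n * h ≤ τ)
    (hy : ∀ k i, y k i = z 0 i + h * ∑ j ∈ Finset.range k, β j i + M k i)
    (hz : ∀ k < n, ∀ i, z (k + 1) i = z k i + h * (β' k i + ρ k i))
    (hρ : ∀ k < n, ∀ i, |ρ k i| ≤ κ) (hM : ∀ k ≤ n, ∀ i, |M k i| ≤ G i)
    (hβ : ∀ k < n, ∀ i, |β k i - β' k i| ≤ L * ∑ j, |y k j - z k j|) :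
    ∑ i, |y n i - z n i| ≤
      (∑ i, G i + Fintype.card I * (τ * κ)) * Real.exp (Fintype.card I * L * τ) := by
  set m : ℝ := (Fintype.card I : ℝ) with hm
  have hm0 : 0 ≤ m := Nat.cast_nonneg _
  set R : ℝ := ∑ i, G i + m * (τ * κ) with hR
  have hG : ∀ i, 0 ≤ G i := fun i => (abs_nonneg _).trans (hM 0 (Nat.zero_le _) i)
  have hτ : 0 ≤ τ := le_trans (by positivity) hn
  have hR0 : 0 ≤ R := add_nonneg (Finset.sum_nonneg fun i _ => hG i) (by positivity)
  have hzk : ∀ k ≤ n, ∀ i, z k i = z 0 i + h * ∑ j ∈ Finset.range k, (β' j i + ρ j i) := by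
    intro k
    induction k with
    | zero => intro _ i; simp
    | succ k ih =>
      intro hk i
      rw [hz k hk, ih (by omega), Finset.sum_range_succ]; ring
  have hmain : ∀ k ≤ n, ∑ i, |y k i - z k i| ≤
      R + m * L * h * ∑ j ∈ Finset.range k, ∑ i, |y j i - z j i| := by
    intro k hk
    have hterm : ∀ i, |y k i - z k i| ≤
        G i + τ * κ + L * h * ∑ j ∈ Finset.range k, ∑ i, |y j i - z j i| := by
      intro i
      have hdec : y k i - z k i = M k i + h * ∑ j ∈ Finset.range k, (β j i - β' j i)
          - h * ∑ j ∈ Finset.range k, ρ j i := by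
        rw [hy, hzk k hk, Finset.sum_add_distrib, Finset.sum_sub_distrib]; ring
      have h1 : |h * ∑ j ∈ Finset.range k, (β j i - β' j i)| ≤
          L * h * ∑ j ∈ Finset.range k, ∑ i, |y j i - z j i| := by
        rw [abs_mul, abs_of_nonneg hh, mul_comm L h, mul_assoc, Finset.mul_sum]
        refine mul_le_mul_of_nonneg_left ((Finset.abs_sum_le_sum_abs _ _).trans ?_) hh
        exact Finset.sum_le_sum fun j hj => hβ j (by have := Finset.mem_range.1 hj; omega) i
      have h2 : |h * ∑ j ∈ Finset.range k, ρ j i| ≤ τ * κ := by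
        rw [abs_mul, abs_of_nonneg hh]
        refine (mul_le_mul_of_nonneg_left ((Finset.abs_sum_le_sum_abs _ _).trans
          (Finset.sum_le_card_nsmul _ _ κ fun j hj =>
            hρ j (by have := Finset.mem_range.1 hj; omega) i)) hh).trans ?_
        rw [Finset.card_range, nsmul_eq_mul, ← mul_assoc, mul_comm h]
        refine mul_le_mul_of_nonneg_right (le_trans ?_ hn) hκ
        exact mul_le_mul_of_nonneg_right (by exact_mod_cast hk) hh
      rw [hdec]
      refine (abs_sub _ _).trans ?_
      have h3 := abs_add_le (M k i) (h * ∑ j ∈ Finset.range k, (β j i - β' j i))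
      have h4 := hM k hk i
      linarith
    refine (Finset.sum_le_sum fun i _ => hterm i).trans (le_of_eq ?_)
    rw [Finset.sum_add_distrib, Finset.sum_add_distrib]
    simp only [Finset.sum_const, Finset.card_univ, nsmul_eq_mul, ← hm, hR]
    ring
  have hq : 0 ≤ m * L * h := by positivity
  have hgron : ∀ k ≤ n, ∑ i, |y k i - z k i| ≤ R * (1 + m * L * h) ^ k := by
    intro k
    induction k using Nat.strong_induction_on with
    | _ k ih =>
      intro hk
      refine (hmain k hk).trans ?_
      have h1 : ∑ j ∈ Finset.range k, ∑ i, |y j i - z j i| ≤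
          ∑ j ∈ Finset.range k, R * (1 + m * L * h) ^ j :=
        Finset.sum_le_sum fun j hj => by
          have := Finset.mem_range.1 hj
          exact ih j this (by omega)
      refine (add_le_add le_rfl (mul_le_mul_of_nonneg_left h1 hq)).trans (le_of_eq ?_)
      rw [← Finset.mul_sum]
      have h2 := mul_geom_sum (1 + m * L * h) k
      rw [add_sub_cancel_left] at h2
      linear_combination R * h2
  refine (hgron n le_rfl).trans (mul_le_mul_of_nonneg_left ?_ hR0)
  calc (1 + m * L * h) ^ n ≤ Real.exp (m * L * h) ^ n :=
        pow_le_pow_left₀ (by positivity) (by linarith [Real.add_one_le_exp (m * L * h)]) n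
    _ = Real.exp (m * L * (n * h)) := by rw [← Real.exp_nat_mul]; ring_nf
    _ ≤ Real.exp (m * L * τ) :=
        Real.exp_le_exp.2 (mul_le_mul_of_nonneg_left hn (by positivity))

theorem softmaxPol_sum_pos {X A : Type*} [Fintype A] [Nonempty A] (θ : X → A → ℝ) (x : X) :
    0 < ∑ a, Real.exp (θ x a) :=
  Finset.sum_pos (fun _ _ => Real.exp_pos _) Finset.univ_nonempty

theorem softmaxPol_pos {X A : Type*} [Fintype A] [Nonempty A] (θ : X → A → ℝ) (x : X) (a : A) :
    0 < softmaxPol θ x a :=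
  div_pos (Real.exp_pos _) (softmaxPol_sum_pos θ x)

theorem sum_softmaxPol {X A : Type*} [Fintype A] [Nonempty A] (θ : X → A → ℝ) (x : X) :
    ∑ a, softmaxPol θ x a = 1 := by
  simp only [softmaxPol, ← Finset.sum_div]
  exact div_self (softmaxPol_sum_pos θ x).ne'

theorem isPolicy_softmaxPol {X A : Type*} [Fintype A] [Nonempty A] (θ : X → A → ℝ) :
    IsPolicy (softmaxPol θ) :=
  ⟨fun x a => (softmaxPol_pos θ x a).le, sum_softmaxPol θ⟩

theorem IsPolicy.abs_le_one {X A : Type*} [Fintype A] {f : X → A → ℝ} (hf : IsPolicy f)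
    (x : X) (a : A) : |f x a| ≤ 1 := by
  rw [abs_of_nonneg (hf.1 x a), ← hf.2 x]
  exact Finset.single_le_sum (fun a _ => hf.1 x a) (Finset.mem_univ a)

theorem isPolicy_explorePol {X A : Type*} [Fintype A] [Nonempty A] {η : ℝ} (h0 : 0 ≤ η)
    (h1 : η ≤ 1) (θ : X → A → ℝ) : IsPolicy (explorePol η θ) := by
  refine ⟨fun x a => ?_, fun x => ?_⟩
  · exact add_nonneg (div_nonneg h0 (Nat.cast_nonneg _))
      (mul_nonneg (sub_nonneg.2 h1) (softmaxPol_pos θ x a).le)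
  · have : (Fintype.card A : ℝ) ≠ 0 := by exact_mod_cast Fintype.card_ne_zero
    simp only [explorePol, Finset.sum_add_distrib, ← Finset.mul_sum, sum_softmaxPol]
    simp only [Finset.sum_const, Finset.card_univ, nsmul_eq_mul]
    field_simp
    ring

theorem explorePol_one_eq {X A : Type*} [Fintype A] (θ : X → A → ℝ) :
    explorePol 1 θ = explorePol 0 (0 : X → A → ℝ) := by
  ext x a
  simp [explorePol, softmaxPol]

theorem continuous_softmaxPol {X A : Type*} [Fintype A] [Nonempty A] :
    Continuous (softmaxPol : (X → A → ℝ) → X → A → ℝ) := by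
  have h : ∀ x a, Continuous fun θ : X → A → ℝ => Real.exp (θ x a) := fun x a =>
    Real.continuous_exp.comp ((continuous_apply a).comp (continuous_apply x))
  exact continuous_pi fun x => continuous_pi fun a =>
    (h x a).div (continuous_finsetSum _ fun a' _ => h x a') fun θ => (softmaxPol_sum_pos θ x).ne'

theorem softmaxPol_sub_le {X A : Type*} [Fintype A] [Nonempty A] {θ θ' : X → A → ℝ} {δ : ℝ}
    (h : ∀ x a, |θ x a - θ' x a| ≤ δ) (x : X) (a : A) :
    softmaxPol θ x a - softmaxPol θ' x a ≤ 2 * δ := by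
  have hS : ∑ a', Real.exp (θ' x a') ≤ Real.exp δ * ∑ a', Real.exp (θ x a') := by
    rw [Finset.mul_sum]
    refine Finset.sum_le_sum fun a' _ => ?_
    rw [← Real.exp_add]
    exact Real.exp_le_exp.2 (by linarith [(abs_le.1 (h x a')).1])
  have hE : Real.exp (-δ) * Real.exp (θ x a) ≤ Real.exp (θ' x a) := by
    rw [← Real.exp_add]
    exact Real.exp_le_exp.2 (by linarith [(abs_le.1 (h x a)).2])
  have h1 : Real.exp (-(2 * δ)) * softmaxPol θ x a ≤ softmaxPol θ' x a := by
    calc Real.exp (-(2 * δ)) * softmaxPol θ x a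
        = Real.exp (-δ) * Real.exp (θ x a) / (Real.exp δ * ∑ a', Real.exp (θ x a')) := by
          rw [softmaxPol, show -(2 * δ) = -δ - δ by ring, Real.exp_sub]
          field_simp
      _ ≤ Real.exp (θ' x a) / ∑ a', Real.exp (θ' x a') :=
          div_le_div₀ (Real.exp_pos _).le hE (softmaxPol_sum_pos θ' x) hS
  have h2 := Real.add_one_le_exp (-(2 * δ))
  have h3 := (le_abs_self _).trans ((isPolicy_softmaxPol θ).abs_le_one x a)
  have h4 := (softmaxPol_pos θ x a).le
  have h5 : 0 ≤ δ := (abs_nonneg _).trans (h x a)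
  nlinarith

theorem abs_softmaxPol_sub_le {X A : Type*} [Fintype A] [Nonempty A] {θ θ' : X → A → ℝ} {δ : ℝ}
    (h : ∀ x a, |θ x a - θ' x a| ≤ δ) (x : X) (a : A) :
    |softmaxPol θ x a - softmaxPol θ' x a| ≤ 2 * δ :=
  abs_sub_le_iff.2 ⟨softmaxPol_sub_le h x a,
    softmaxPol_sub_le (fun x a => by rw [abs_sub_comm]; exact h x a) x a⟩

theorem abs_explorePol_sub_le {X A : Type*} [Fintype A] [Nonempty A] {η : ℝ} (h0 : 0 ≤ η)
    (h1 : η ≤ 1) {θ θ' : X → A → ℝ} {δ : ℝ} (h : ∀ x a, |θ x a - θ' x a| ≤ δ) (x : X) (a : A) :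
    |explorePol η θ x a - explorePol η θ' x a| ≤ 2 * δ := by
  have : explorePol η θ x a - explorePol η θ' x a
      = (1 - η) * (softmaxPol θ x a - softmaxPol θ' x a) := by
    simp only [explorePol]; ring
  rw [this, abs_mul, abs_of_nonneg (sub_nonneg.2 h1)]
  exact (mul_le_of_le_one_left (abs_nonneg _) (by linarith)).trans (abs_softmaxPol_sub_le h x a)

theorem etaT_pos (t : ℝ) : 0 < etaT t := inv_pos.2 (by positivity)

theorem etaT_le_one (t : ℝ) : etaT t ≤ 1 :=
  inv_le_one_of_one_le₀ (by linarith [sq_nonneg (Real.log (t + 1))])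

theorem continuous_etaT : Continuous fun t : NNReal => etaT t := by
  have h1 : Continuous fun t : NNReal => Real.log ((t : ℝ) + 1) :=
    (NNReal.continuous_coe.add continuous_const).log fun t =>
      (add_pos_of_nonneg_of_pos t.2 one_pos).ne'
  exact (continuous_const.add (h1.pow 2)).inv₀ fun t =>
    (add_pos_of_pos_of_nonneg one_pos (sq_nonneg _)).ne'

theorem continuous_zetaT : Continuous fun t : NNReal => zetaT t :=
  (continuous_const.add NNReal.continuous_coe).inv₀ fun t =>
    (add_pos_of_pos_of_nonneg one_pos t.2).ne'

theorem abs_zetaT_le_one (t : NNReal) : |zetaT t| ≤ 1 := by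
  have : 0 ≤ zetaT t := inv_nonneg.2 (by positivity)
  rw [abs_of_nonneg this]
  exact inv_le_one_of_one_le₀ (by linarith [t.2])

theorem continuous_apply_of_sum_abs_sub_le {X A S : Type*} [Fintype X] [Fintype A] [Fintype S]
    {u : (X → A → ℝ) → S → ℝ}
    (hu : ∃ L : ℝ, ∀ f f' : X → A → ℝ,
      ∑ s, |u f s - u f' s| ≤ L * ∑ x, ∑ a, |f x a - f' x a|) (s : S) :
    Continuous fun f => u f s := by
  obtain ⟨L, hL⟩ := hu
  refine continuous_iff_continuousAt.2 fun f₀ => tendsto_iff_dist_tendsto_zero.2 ?_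
  have hc : Continuous fun f : X → A → ℝ => L * ∑ x, ∑ a, |f x a - f₀ x a| := by fun_prop
  refine squeeze_zero (fun _ => dist_nonneg) (fun f => ?_) (by simpa using hc.tendsto f₀)
  rw [Real.dist_eq]
  exact (Finset.single_le_sum (f := fun s => |u f s - u f₀ s|) (fun _ _ => abs_nonneg _)
    (Finset.mem_univ s)).trans (hL f f₀)

theorem sum_criticKer {X A : Type*} [Fintype X] [Fintype A] {q : X → A → X → ℝ}
    (hq : ∀ x a, ∑ x', q x a x' = 1) {f : X → A → ℝ} (hf : IsPolicy f) (s : X × A) :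
    ∑ s', criticKer q f s s' = 1 := by
  simp only [criticKer, Fintype.sum_prod_type, ← Finset.mul_sum, hf.2, mul_one, hq]

theorem IsStationaryDist.abs_le_one {S : Type*} [Fintype S] {K : S → S → ℝ} {d : S → ℝ}
    (h : IsStationaryDist K d) (s : S) : |d s| ≤ 1 := by
  rw [abs_of_nonneg (h.1 s), ← h.2.1]
  exact Finset.single_le_sum (fun s _ => h.1 s) (Finset.mem_univ s)

theorem IsStationaryDist.mul_policy_comm {X A : Type*} [Fintype X] [Fintype A]
    {q : X → A → X → ℝ} {f : X → A → ℝ} {d : X × A → ℝ}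
    (h : IsStationaryDist (criticKer q f) d) (x : X) (a a' : A) :
    d (x, a) * f x a' = d (x, a') * f x a := by
  have h' : ∀ a, d (x, a) = (∑ s : X × A, d s * q s.1 s.2 x) * f x a := fun a => by
    rw [h.2.2 (x, a), Finset.sum_mul]
    exact Finset.sum_congr rfl fun s _ => by simp only [criticKer]; ring
  rw [h' a, h' a']; ring

/-- Bounded and Lipschitz, with respect to a gauge `δ`, along related pairs of points. -/
def IsBddLip {E : Type*} (R : E → E → Prop) (δ : E → E → ℝ) (u : E → ℝ) : Prop :=
  ∃ C, 0 ≤ C ∧ ∀ e e', R e e' → |u e| ≤ C ∧ |u e'| ≤ C ∧ |u e - u e'| ≤ C * δ e e'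

namespace IsBddLip

variable {E : Type*} {R : E → E → Prop} {δ : E → E → ℝ} {u v : E → ℝ}

theorem of_eq (hδ : ∀ e e', 0 ≤ δ e e') (C : ℝ) (hC : 0 ≤ C) (hu : ∀ e, |u e| ≤ C)
    (h : ∀ e e', R e e' → u e = u e') : IsBddLip R δ u :=
  ⟨C, hC, fun e e' he => ⟨hu e, hu e', by
    rw [h e e' he, sub_self, abs_zero]; exact mul_nonneg hC (hδ e e')⟩⟩

theorem const (hδ : ∀ e e', 0 ≤ δ e e') (c : ℝ) : IsBddLip R δ fun _ => c :=
  of_eq hδ |c| (abs_nonneg c) (fun _ => le_rfl) fun _ _ _ => rfl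

theorem add (hu : IsBddLip R δ u) (hv : IsBddLip R δ v) : IsBddLip R δ fun e => u e + v e := by
  obtain ⟨C, hC, h⟩ := hu
  obtain ⟨C', hC', h'⟩ := hv
  refine ⟨C + C', add_nonneg hC hC', fun e e' he => ?_⟩
  obtain ⟨h1, h2, h3⟩ := h e e' he
  obtain ⟨h1', h2', h3'⟩ := h' e e' he
  refine ⟨(abs_add_le _ _).trans (add_le_add h1 h1'),
    (abs_add_le _ _).trans (add_le_add h2 h2'), ?_⟩
  rw [add_sub_add_comm, add_mul]
  exact (abs_add_le _ _).trans (add_le_add h3 h3')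

theorem mul (hu : IsBddLip R δ u) (hv : IsBddLip R δ v) : IsBddLip R δ fun e => u e * v e := by
  obtain ⟨C, hC, h⟩ := hu
  obtain ⟨C', hC', h'⟩ := hv
  have hCC := mul_nonneg hC hC'
  refine ⟨2 * (C * C'), by positivity, fun e e' he => ?_⟩
  obtain ⟨h1, h2, h3⟩ := h e e' he
  obtain ⟨h1', h2', h3'⟩ := h' e e' he
  have b1 : |u e * v e| ≤ C * C' := by
    rw [abs_mul]; exact mul_le_mul h1 h1' (abs_nonneg _) hC
  have b2 : |u e' * v e'| ≤ C * C' := by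
    rw [abs_mul]; exact mul_le_mul h2 h2' (abs_nonneg _) hC
  refine ⟨by linarith, by linarith, ?_⟩
  have : u e * v e - u e' * v e' = u e * (v e - v e') + (u e - u e') * v e' := by ring
  rw [this]
  refine (abs_add_le _ _).trans ?_
  rw [abs_mul, abs_mul]
  have c1 := mul_le_mul h1 h3' (abs_nonneg _) hC
  have c2 := mul_le_mul h3 h2' (abs_nonneg _) ((abs_nonneg _).trans h3)
  linarith

theorem sub (hδ : ∀ e e', 0 ≤ δ e e') (hu : IsBddLip R δ u) (hv : IsBddLip R δ v) :
    IsBddLip R δ fun e => u e - v e := by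
  have := hu.add ((const hδ (-1)).mul hv)
  simpa only [neg_one_mul, ← sub_eq_add_neg] using this

theorem sum (hδ : ∀ e e', 0 ≤ δ e e') {ι : Type*} (s : Finset ι) {w : ι → E → ℝ}
    (hw : ∀ i, IsBddLip R δ (w i)) : IsBddLip R δ fun e => ∑ i ∈ s, w i e := by
  induction s using Finset.induction_on with
  | empty => simpa using const hδ 0
  | insert i s hi ih => simpa only [Finset.sum_insert hi] using (hw i).add ih

end IsBddLip

theorem IsBddLip.exists_common {E I : Type*} [Fintype I] {R : E → E → Prop} {δ : E → E → ℝ}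
    (hδ : ∀ e e', 0 ≤ δ e e') {u : I → E → ℝ} (hu : ∀ i, IsBddLip R δ (u i)) :
    ∃ L, 0 ≤ L ∧ ∀ i e e', R e e' → |u i e - u i e'| ≤ L * δ e e' := by
  choose C hC h using hu
  refine ⟨∑ i, C i, Finset.sum_nonneg fun i _ => hC i, fun i e e' he =>
    (h i e e' he).2.2.trans (mul_le_mul_of_nonneg_right ?_ (hδ e e'))⟩
  exact Finset.single_le_sum (fun i _ => hC i) (Finset.mem_univ i)

/-- Rescaled time, actor parameter and critic of the actor-critic dynamics. -/
abbrev ACState (X A : Type*) := NNReal × (X → A → ℝ) × (X → A → ℝ)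

namespace ACState

variable {X A : Type*}

def critic (e : ACState X A) (i : X × A) : ℝ := e.2.2 i.1 i.2

def actorPol [Fintype A] (e : ACState X A) : X → A → ℝ := softmaxPol e.2.1

def criticPol [Fintype A] (e : ACState X A) : X → A → ℝ := explorePol (etaT e.1) e.2.1

def criticIncr [Fintype A] [DecidableEq X] [DecidableEq A] (r : X → A → ℝ) (γ α : ℝ)
    (i : X × A) (e : ACState X A) (s s' : X × A) : ℝ :=
  α * (r s.1 s.2 + γ * (∑ a'', e.critic (s'.1, a'') * e.criticPol s'.1 a'') - e.critic s) *
    (if s.1 = i.1 ∧ s.2 = i.2 then 1 else 0)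

def criticDrift [Fintype X] [Fintype A] (p : X → A → X → ℝ) (r : X → A → ℝ) (γ α : ℝ)
    (pista : (X → A → ℝ) → X × A → ℝ) (i : X × A) (e : ACState X A) : ℝ :=
  α * pista e.criticPol i *
    (r i.1 i.2 + γ * (∑ z, ∑ a'', e.critic (z, a'') * e.criticPol z a'' * p i.1 i.2 z) -
      e.critic i)

def actorIncr [Fintype A] [DecidableEq X] [DecidableEq A]
    (i : X × A) (e : ACState X A) (s _s' : X × A) : ℝ :=
  zetaT e.1 * e.critic s * (if s.1 = i.1 then 1 else 0) *
    ((if s.2 = i.2 then 1 else 0) - e.actorPol s.1 i.2)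

def actorDrift [Fintype A] (sigsta : (X → A → ℝ) → X × A → ℝ) (i : X × A)
    (e : ACState X A) : ℝ :=
  zetaT e.1 * sigsta e.actorPol i *
    (e.critic i - ∑ a', e.critic (i.1, a') * e.actorPol i.1 a')

def gauge [Fintype X] [Fintype A] (e e' : ACState X A) : ℝ :=
  (∑ x, ∑ a, |e.2.1 x a - e'.2.1 x a|) + ∑ x, ∑ a, |e.2.2 x a - e'.2.2 x a|

def Related (R : ℝ) (e e' : ACState X A) : Prop :=
  e.1 = e'.1 ∧ (∀ i, |e.critic i| ≤ R) ∧ ∀ i, |e'.critic i| ≤ R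

theorem continuous_critic (i : X × A) : Continuous fun e : ACState X A => e.critic i :=
  (continuous_apply i.2).comp ((continuous_apply i.1).comp (continuous_snd.comp continuous_snd))

theorem gauge_nonneg [Fintype X] [Fintype A] (e e' : ACState X A) : 0 ≤ gauge e e' :=
  add_nonneg (Finset.sum_nonneg fun _ _ => Finset.sum_nonneg fun _ _ => abs_nonneg _)
    (Finset.sum_nonneg fun _ _ => Finset.sum_nonneg fun _ _ => abs_nonneg _)

theorem abs_sub_le_sum_sum [Fintype X] [Fintype A] (f f' : X → A → ℝ) (x : X) (a : A) :
    |f x a - f' x a| ≤ ∑ x, ∑ a, |f x a - f' x a| :=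
  (Finset.single_le_sum (f := fun a => |f x a - f' x a|) (fun _ _ => abs_nonneg _)
    (Finset.mem_univ a)).trans (Finset.single_le_sum (f := fun x => ∑ a, |f x a - f' x a|)
    (fun _ _ => Finset.sum_nonneg fun _ _ => abs_nonneg _) (Finset.mem_univ x))

theorem abs_actor_sub_le_gauge [Fintype X] [Fintype A] (e e' : ACState X A)
    (x : X) (a : A) :
    |e.2.1 x a - e'.2.1 x a| ≤ gauge e e' :=
  (abs_sub_le_sum_sum _ _ x a).trans (le_add_of_nonneg_right
    (Finset.sum_nonneg fun _ _ => Finset.sum_nonneg fun _ _ => abs_nonneg _))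

theorem abs_critic_sub_le_gauge [Fintype X] [Fintype A] (e e' : ACState X A) (i : X × A) :
    |e.critic i - e'.critic i| ≤ gauge e e' :=
  (abs_sub_le_sum_sum e.2.2 e'.2.2 i.1 i.2).trans (le_add_of_nonneg_left
    (Finset.sum_nonneg fun _ _ => Finset.sum_nonneg fun _ _ => abs_nonneg _))

theorem isBddLip_critic [Fintype X] [Fintype A] {R : ℝ} (hR : 0 ≤ R) (i : X × A) :
    IsBddLip (Related R) gauge fun e : ACState X A => e.critic i := by
  refine ⟨R + 1, by positivity, fun e e' he => ⟨(he.2.1 i).trans (by linarith),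
    (he.2.2 i).trans (by linarith), (abs_critic_sub_le_gauge e e' i).trans ?_⟩⟩
  nlinarith [gauge_nonneg e e']

variable [Fintype A] [Nonempty A]

theorem isPolicy_actorPol (e : ACState X A) : IsPolicy e.actorPol := isPolicy_softmaxPol _

theorem isPolicy_criticPol (e : ACState X A) : IsPolicy e.criticPol :=
  isPolicy_explorePol (etaT_pos _).le (etaT_le_one _) _

theorem continuous_actorPol : Continuous fun e : ACState X A => e.actorPol :=
  continuous_softmaxPol.comp (continuous_fst.comp continuous_snd)

theorem continuous_criticPol : Continuous fun e : ACState X A => e.criticPol := by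
  have h1 : Continuous fun e : ACState X A => etaT e.1 := continuous_etaT.comp continuous_fst
  refine continuous_pi fun x => continuous_pi fun a => ?_
  exact (h1.div_const _).add ((continuous_const.sub h1).mul
    ((continuous_apply a).comp ((continuous_apply x).comp continuous_actorPol)))

theorem continuous_criticIncr [DecidableEq X] [DecidableEq A] (r : X → A → ℝ) (γ α : ℝ)
    (i s s' : X × A) : Continuous fun e : ACState X A => criticIncr r γ α i e s s' := by
  have hg : ∀ x a, Continuous fun e : ACState X A => e.criticPol x a := fun x a =>
    (continuous_apply a).comp ((continuous_apply x).comp continuous_criticPol)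
  refine (continuous_const.mul ((continuous_const.add (continuous_const.mul
    (continuous_finsetSum _ fun a _ => (continuous_critic _).mul (hg _ _)))).sub
    (continuous_critic s))).mul continuous_const

theorem continuous_actorIncr [DecidableEq X] [DecidableEq A] (i s s' : X × A) :
    Continuous fun e : ACState X A => actorIncr i e s s' := by
  have hf : ∀ x a, Continuous fun e : ACState X A => e.actorPol x a := fun x a =>
    (continuous_apply a).comp ((continuous_apply x).comp continuous_actorPol)
  exact (((continuous_zetaT.comp continuous_fst).mul (continuous_critic s)).mul
    continuous_const).mul (continuous_const.sub (hf _ _))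

theorem continuous_actorDrift {sigsta : (X → A → ℝ) → X × A → ℝ}
    (hsig : ∀ s, Continuous fun f => sigsta f s) (i : X × A) :
    Continuous fun e : ACState X A => actorDrift sigsta i e := by
  have hf : ∀ x a, Continuous fun e : ACState X A => e.actorPol x a := fun x a =>
    (continuous_apply a).comp ((continuous_apply x).comp continuous_actorPol)
  exact ((continuous_zetaT.comp continuous_fst).mul ((hsig i).comp continuous_actorPol)).mul
    ((continuous_critic i).sub (continuous_finsetSum _ fun a _ =>
      (continuous_critic _).mul (hf _ _)))

variable [Fintype X]

theorem criticDrift_eq_sum [DecidableEq X] [DecidableEq A] {p : X → A → X → ℝ}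
    (hp1 : ∀ x a, ∑ x', p x a x' = 1) (r : X → A → ℝ) (γ α : ℝ)
    (pista : (X → A → ℝ) → X × A → ℝ) (i : X × A) (e : ACState X A) :
    criticDrift p r γ α pista i e = ∑ s, pista e.criticPol s *
      ∑ s', criticKer p e.criticPol s s' * criticIncr r γ α i e s s' := by
  rw [Finset.sum_eq_single i]
  · simp only [criticDrift, criticIncr, and_self, if_true, mul_one]
    have h : ∑ s', criticKer p e.criticPol i s' * (α * (r i.1 i.2 +
        γ * (∑ a'', e.critic (s'.1, a'') * e.criticPol s'.1 a'') - e.critic i)) =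
        α * ((∑ s', criticKer p e.criticPol i s') * (r i.1 i.2 - e.critic i) +
          γ * ∑ s', criticKer p e.criticPol i s' *
            ∑ a'', e.critic (s'.1, a'') * e.criticPol s'.1 a'') := by
      rw [Finset.sum_mul, Finset.mul_sum, ← Finset.sum_add_distrib, Finset.mul_sum]
      exact Finset.sum_congr rfl fun s' _ => by ring
    have h2 : ∑ s', criticKer p e.criticPol i s' *
            ∑ a'', e.critic (s'.1, a'') * e.criticPol s'.1 a'' =
          ∑ z, ∑ a'', e.critic (z, a'') * e.criticPol z a'' * p i.1 i.2 z := by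
      rw [Fintype.sum_prod_type]
      refine Finset.sum_congr rfl fun z _ => ?_
      simp only [criticKer]
      rw [← Finset.sum_mul, ← Finset.mul_sum, e.isPolicy_criticPol.2, mul_one, ← Finset.sum_mul,
        mul_comm]
    rw [h, h2, sum_criticKer hp1 e.isPolicy_criticPol]
    ring
  · intro s _ hs
    have : ¬ (s.1 = i.1 ∧ s.2 = i.2) := fun h => hs (Prod.ext h.1 h.2)
    simp [criticIncr, this]
  · simp

theorem actorDrift_eq_sum [DecidableEq X] [DecidableEq A] {q : X → A → X → ℝ}
    (hq1 : ∀ x a, ∑ x', q x a x' = 1)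
    {sigsta : (X → A → ℝ) → X × A → ℝ} (i : X × A) (e : ACState X A)
    (hsig : IsStationaryDist (criticKer q e.actorPol) (sigsta e.actorPol)) :
    actorDrift sigsta i e = ∑ s, sigsta e.actorPol s *
      ∑ s', criticKer q e.actorPol s s' * actorIncr i e s s' := by
  have h1 : ∀ s, ∑ s', criticKer q e.actorPol s s' * actorIncr i e s s' =
      actorIncr i e s s := fun s => by
    simp only [actorIncr]
    rw [← Finset.sum_mul, sum_criticKer hq1 e.isPolicy_actorPol, one_mul]
  simp_rw [h1]
  rw [Fintype.sum_prod_type, Finset.sum_eq_single i.1]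
  · simp only [actorIncr, actorDrift, if_true, mul_one, mul_sub, mul_ite, mul_zero,
      Finset.sum_sub_distrib, Finset.sum_ite_eq', Finset.mem_univ, Finset.mul_sum]
    congr 1
    · ring
    · refine Finset.sum_congr rfl fun a' _ => ?_
      linear_combination (zetaT e.1 * e.critic (i.1, a')) * hsig.mul_policy_comm i.1 i.2 a'
  · intro x _ hx
    simp [actorIncr, hx]
  · simp

theorem continuous_criticDrift {p : X → A → X → ℝ} {r : X → A → ℝ} {γ α : ℝ}
    {pista : (X → A → ℝ) → X × A → ℝ} (hpi : ∀ s, Continuous fun f => pista f s) (i : X × A) :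
    Continuous fun e : ACState X A => criticDrift p r γ α pista i e := by
  have hg : ∀ x a, Continuous fun e : ACState X A => e.criticPol x a := fun x a =>
    (continuous_apply a).comp ((continuous_apply x).comp continuous_criticPol)
  exact (continuous_const.mul ((hpi i).comp continuous_criticPol)).mul
    ((continuous_const.add (continuous_const.mul (continuous_finsetSum _ fun z _ =>
      continuous_finsetSum _ fun a _ => ((continuous_critic _).mul (hg _ _)).mul
        continuous_const))).sub (continuous_critic i))

theorem isBddLip_actorPol (R : ℝ) (x : X) (a : A) :
    IsBddLip (Related R) gauge fun e : ACState X A => e.actorPol x a :=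
  ⟨2, by norm_num, fun e e' _ =>
    ⟨(e.isPolicy_actorPol.abs_le_one x a).trans (by norm_num),
      (e'.isPolicy_actorPol.abs_le_one x a).trans (by norm_num),
      abs_softmaxPol_sub_le (abs_actor_sub_le_gauge e e') x a⟩⟩

theorem isBddLip_criticPol (R : ℝ) (x : X) (a : A) :
    IsBddLip (Related R) gauge fun e : ACState X A => e.criticPol x a := by
  refine ⟨2, by norm_num, fun e e' he =>
    ⟨(e.isPolicy_criticPol.abs_le_one x a).trans (by norm_num),
      (e'.isPolicy_criticPol.abs_le_one x a).trans (by norm_num), ?_⟩⟩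
  show |explorePol (etaT e.1) e.2.1 x a - explorePol (etaT e'.1) e'.2.1 x a| ≤ _
  rw [he.1]
  exact abs_explorePol_sub_le (etaT_pos _).le (etaT_le_one _) (abs_actor_sub_le_gauge e e') x a

theorem isBddLip_comp_policy {R : ℝ} {pol : ACState X A → X → A → ℝ}
    (hpol : ∀ x a, IsBddLip (Related R) gauge fun e => pol e x a)
    {u : (X → A → ℝ) → X × A → ℝ} (hu1 : ∀ e s, |u (pol e) s| ≤ 1)
    (hu : ∃ L : ℝ, ∀ f f' : X → A → ℝ,
      ∑ s, |u f s - u f' s| ≤ L * ∑ x, ∑ a, |f x a - f' x a|) (s : X × A) :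
    IsBddLip (Related R) gauge fun e => u (pol e) s := by
  obtain ⟨L, hL⟩ := hu
  obtain ⟨C, hC, h⟩ := IsBddLip.exists_common gauge_nonneg
    (u := fun (i : X × A) e => pol e i.1 i.2) fun i => hpol _ _
  set m : ℝ := (Fintype.card X : ℝ) * Fintype.card A with hm
  have hm0 : 0 ≤ m := by positivity
  refine ⟨1 + |L| * (m * C), by positivity, fun e e' he => ⟨(hu1 e s).trans ?_,
    (hu1 e' s).trans ?_, ?_⟩⟩
  · have : 0 ≤ |L| * (m * C) := by positivity
    linarith
  · have : 0 ≤ |L| * (m * C) := by positivity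
    linarith
  · have hg := gauge_nonneg e e'
    have h1 : ∑ x, ∑ a, |pol e x a - pol e' x a| ≤ m * (C * gauge e e') := by
      refine (Finset.sum_le_sum fun x _ => Finset.sum_le_sum fun a _ =>
        h (x, a) e e' he).trans (le_of_eq ?_)
      simp [hm, mul_assoc]
    have h2 : 0 ≤ ∑ x, ∑ a, |pol e x a - pol e' x a| :=
      Finset.sum_nonneg fun _ _ => Finset.sum_nonneg fun _ _ => abs_nonneg _
    have h3 := (Finset.single_le_sum (f := fun s => |u (pol e) s - u (pol e') s|)
      (fun _ _ => abs_nonneg _) (Finset.mem_univ s)).trans (hL (pol e) (pol e'))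
    have h4 := mul_le_mul_of_nonneg_right (le_abs_self L) h2
    have h5 := mul_le_mul_of_nonneg_left h1 (abs_nonneg L)
    linarith

theorem isBddLip_criticDrift {R : ℝ} (hR : 0 ≤ R) (p : X → A → X → ℝ) (r : X → A → ℝ) (γ α : ℝ)
    {pista : (X → A → ℝ) → X × A → ℝ} (hpi1 : ∀ (e : ACState X A) s, |pista e.criticPol s| ≤ 1)
    (hpi : ∃ L : ℝ, ∀ f f' : X → A → ℝ,
      ∑ s, |pista f s - pista f' s| ≤ L * ∑ x, ∑ a, |f x a - f' x a|) (i : X × A) :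
    IsBddLip (Related R) gauge fun e => criticDrift p r γ α pista i e := by
  have hc : ∀ c : ℝ, IsBddLip (Related R) gauge fun _ : ACState X A => c :=
    IsBddLip.const gauge_nonneg
  exact ((hc α).mul (isBddLip_comp_policy (isBddLip_criticPol R) hpi1 hpi i)).mul
    (((hc _).add ((hc γ).mul (IsBddLip.sum gauge_nonneg _ fun z =>
      IsBddLip.sum gauge_nonneg _ fun a => ((isBddLip_critic hR _).mul
        (isBddLip_criticPol R z a)).mul (hc _)))).sub gauge_nonneg (isBddLip_critic hR i))

theorem isBddLip_actorDrift {R : ℝ} (hR : 0 ≤ R)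
    {sigsta : (X → A → ℝ) → X × A → ℝ} (hsig1 : ∀ (e : ACState X A) s, |sigsta e.actorPol s| ≤ 1)
    (hsig : ∃ L : ℝ, ∀ f f' : X → A → ℝ,
      ∑ s, |sigsta f s - sigsta f' s| ≤ L * ∑ x, ∑ a, |f x a - f' x a|) (i : X × A) :
    IsBddLip (Related R) gauge fun e => actorDrift sigsta i e := by
  have hζ : IsBddLip (Related R) gauge fun e : ACState X A => zetaT e.1 :=
    IsBddLip.of_eq gauge_nonneg 1 zero_le_one (fun e => abs_zetaT_le_one e.1)
      fun e e' he => by rw [he.1]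
  exact (hζ.mul (isBddLip_comp_policy (isBddLip_actorPol R) hsig1 hsig i)).mul
    ((isBddLip_critic hR i).sub gauge_nonneg (IsBddLip.sum gauge_nonneg _ fun a =>
      (isBddLip_critic hR _).mul (isBddLip_actorPol R _ a)))

end ACState

theorem IsPolicy.abs_sum_mul_le {X A : Type*} [Fintype A] {f : X → A → ℝ} (hf : IsPolicy f)
    (x : X) {v : A → ℝ} {R : ℝ} (hv : ∀ a, |v a| ≤ R) : |∑ a, v a * f x a| ≤ R := by
  refine (Finset.abs_sum_le_sum_abs _ _).trans ?_
  calc ∑ a, |v a * f x a| ≤ ∑ a, R * f x a := Finset.sum_le_sum fun a _ => by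
        rw [abs_mul, abs_of_nonneg (hf.1 x a)]
        exact mul_le_mul_of_nonneg_right (hv a) (hf.1 x a)
    _ = R := by rw [← Finset.mul_sum, hf.2, mul_one]

theorem exists_explorePol_etaT_eq {X A : Type*} [Fintype A] (t : ℝ) (θ : X → A → ℝ) :
    ∃ (η : ℝ) (θ' : X → A → ℝ), 0 ≤ η ∧ η < 1 ∧ explorePol (etaT t) θ = explorePol η θ' := by
  rcases (etaT_le_one t).lt_or_eq with h | h
  · exact ⟨etaT t, θ, (etaT_pos t).le, h, rfl⟩
  · exact ⟨0, 0, le_rfl, one_pos, by rw [h, explorePol_one_eq]⟩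

namespace ACState

variable {X A : Type*}

def actor (e : ACState X A) (i : X × A) : ℝ := e.2.1 i.1 i.2

theorem gauge_eq [Fintype X] [Fintype A] (e e' : ACState X A) :
    gauge e e' = ∑ j : (X × A) ⊕ (X × A),
      |Sum.elim e.actor e.critic j - Sum.elim e'.actor e'.critic j| := by
  simp [gauge, Fintype.sum_sum_type, Fintype.sum_prod_type, actor, critic]

theorem gauge_triangle [Fintype X] [Fintype A] (e e' e'' : ACState X A) :
    gauge e e'' ≤ gauge e e' + gauge e' e'' := by
  simp only [gauge_eq, ← Finset.sum_add_distrib]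
  exact Finset.sum_le_sum fun _ _ => abs_sub_le _ _ _

theorem dist_le_of_abs_sub_le [Fintype X] [Fintype A] {e e' : ACState X A} {δ : ℝ} (hδ : 0 ≤ δ)
    (ht : dist e.1 e'.1 ≤ δ) (ha : ∀ i, |e.actor i - e'.actor i| ≤ δ)
    (hc : ∀ i, |e.critic i - e'.critic i| ≤ δ) : dist e e' ≤ δ := by
  rw [Prod.dist_eq, Prod.dist_eq]
  refine max_le ht (max_le ?_ ?_)
  · exact (dist_pi_le_iff hδ).2 fun x => (dist_pi_le_iff hδ).2 fun a => ha (x, a)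
  · exact (dist_pi_le_iff hδ).2 fun x => (dist_pi_le_iff hδ).2 fun a => hc (x, a)

theorem isCompact_setOf_abs_le [Fintype X] [Fintype A] (T : NNReal) (R R' : ℝ) :
    IsCompact {e : ACState X A | e.1 ≤ T ∧ (∀ i, |e.actor i| ≤ R) ∧ ∀ i, |e.critic i| ≤ R'} := by
  have h : ∀ R : ℝ, IsCompact {f : X → A → ℝ | ∀ x, ∀ a, f x a ∈ Icc (-R) R} := fun R => by
    have := isCompact_univ_pi fun _ : X => isCompact_univ_pi fun _ : A =>
      isCompact_Icc (a := -R) (b := R)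
    simpa [Set.pi] using this
  convert (isCompact_Icc (a := (0 : NNReal)) (b := T)).prod ((h R).prod (h R')) using 1
  ext e
  simp [actor, critic, abs_le, Prod.forall]

variable [Fintype A] [Nonempty A]

section Increments

variable {r : X → A → ℝ} {γ α R : ℝ} {e : ACState X A}

theorem abs_reward_add_le (hr : ∀ x a, 0 ≤ r x a ∧ r x a ≤ 1) (hγ : 0 < γ)
    (he : ∀ i, |e.critic i| ≤ R) (s : X × A) (x : X) :
    |r s.1 s.2 + γ * ∑ a, e.critic (x, a) * e.criticPol x a| ≤ 1 + γ * R := by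
  have h := e.isPolicy_criticPol.abs_sum_mul_le x fun a => he (x, a)
  refine (abs_add_le _ _).trans (add_le_add ?_ ?_)
  · rw [abs_of_nonneg (hr _ _).1]
    exact (hr _ _).2
  · rw [abs_mul, abs_of_pos hγ]
    exact mul_le_mul_of_nonneg_left h hγ.le

variable [DecidableEq X] [DecidableEq A]

theorem abs_critic_add_criticIncr_le (hr : ∀ x a, 0 ≤ r x a ∧ r x a ≤ 1) (hγ : 0 < γ)
    (hα : 0 < α) (hR : 1 + γ * R ≤ R) {h : ℝ} (h0 : 0 ≤ h) (hh : h * α ≤ 1)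
    (he : ∀ i, |e.critic i| ≤ R) (i s s' : X × A) :
    |e.critic i + h * criticIncr r γ α i e s s'| ≤ R := by
  by_cases hs : s.1 = i.1 ∧ s.2 = i.2
  · obtain rfl : s = i := Prod.ext hs.1 hs.2
    have h1 := (abs_reward_add_le hr hγ he s s'.1).trans hR
    have hc : 0 ≤ h * α := by positivity
    have h3 := he s
    rw [show e.critic s + h * criticIncr r γ α s e s s' = (1 - h * α) * e.critic s +
      h * α * (r s.1 s.2 + γ * ∑ a, e.critic (s'.1, a) * e.criticPol s'.1 a) by
        simp only [criticIncr, and_self, if_true]; ring]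
    rw [abs_le] at *
    constructor <;> nlinarith
  · simpa [criticIncr, hs] using he i

theorem abs_criticIncr_le (hr : ∀ x a, 0 ≤ r x a ∧ r x a ≤ 1) (hγ : 0 < γ)
    (hα : 0 < α) (hR : 1 + γ * R ≤ R) (he : ∀ i, |e.critic i| ≤ R) (i s s' : X × A) :
    |criticIncr r γ α i e s s'| ≤ α * (2 * R) := by
  have h1 := (abs_reward_add_le hr hγ he s s'.1).trans hR
  have h0 := abs_nonneg (r s.1 s.2 + γ * ∑ a, e.critic (s'.1, a) * e.criticPol s'.1 a)
  have h2 := (abs_sub (r s.1 s.2 + γ * ∑ a, e.critic (s'.1, a) * e.criticPol s'.1 a)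
    (e.critic s)).trans (add_le_add h1 (he s))
  rw [criticIncr, mul_assoc, abs_mul, abs_of_pos hα]
  refine mul_le_mul_of_nonneg_left ?_ hα.le
  split_ifs
  · rw [mul_one]; linarith
  · rw [mul_zero, abs_zero]; linarith

theorem abs_actorIncr_le (he : ∀ i, |e.critic i| ≤ R) (i s s' : X × A) :
    |actorIncr i e s s'| ≤ R := by
  have hR : 0 ≤ R := (abs_nonneg _).trans (he i)
  have h1 := abs_zetaT_le_one e.1
  have h2 : |(if s.2 = i.2 then (1 : ℝ) else 0) - e.actorPol s.1 i.2| ≤ 1 := by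
    have h3 := e.isPolicy_actorPol.abs_le_one s.1 i.2
    have h4 := e.isPolicy_actorPol.1 s.1 i.2
    rw [abs_le] at *
    split_ifs <;> constructor <;> linarith
  have h3 : |(if s.1 = i.1 then (1 : ℝ) else 0)| ≤ 1 := by split_ifs <;> simp
  rw [actorIncr, abs_mul, abs_mul, abs_mul]
  calc _ ≤ 1 * R * 1 * 1 := by gcongr; exact he s
    _ = R := by ring

end Increments

end ACState

/-- A sample path of the actor-critic recursion with step size `1 / N`, driven by the critic
samples `sc` and the actor samples `sa`. -/
structure IsACPath {X A : Type*} [Fintype A] [DecidableEq X] [DecidableEq A]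
    (r : X → A → ℝ) (γ α : ℝ) (N : ℕ) (e : ℕ → ACState X A) (sc sa : ℕ → X × A) : Prop where
  time : ∀ k, (e k).1 = k / N
  critic_succ : ∀ k i, (e (k + 1)).critic i =
    (e k).critic i + (N : ℝ)⁻¹ * ACState.criticIncr r γ α i (e k) (sc k) (sc (k + 1))
  actor_succ : ∀ k i, (e (k + 1)).actor i =
    (e k).actor i + (N : ℝ)⁻¹ * ACState.actorIncr i (e k) (sa k) (sa (k + 1))

namespace IsACPath

open ACState

variable {X A : Type*} [Fintype A] [DecidableEq X] [DecidableEq A] {r : X → A → ℝ}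
  {γ α R : ℝ} {N : ℕ} {e : ℕ → ACState X A} {sc sa : ℕ → X × A}

theorem critic_eq_add_sum (h : IsACPath r γ α N e sc sa) (k : ℕ) (i : X × A) :
    (e k).critic i = (e 0).critic i + (N : ℝ)⁻¹ *
      ∑ j ∈ Finset.range k, criticIncr r γ α i (e j) (sc j) (sc (j + 1)) := by
  induction k with
  | zero => simp
  | succ k ih => rw [h.critic_succ, ih, Finset.sum_range_succ]; ring

theorem actor_eq_add_sum (h : IsACPath r γ α N e sc sa) (k : ℕ) (i : X × A) :
    (e k).actor i = (e 0).actor i + (N : ℝ)⁻¹ *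
      ∑ j ∈ Finset.range k, actorIncr i (e j) (sa j) (sa (j + 1)) := by
  induction k with
  | zero => simp
  | succ k ih => rw [h.actor_succ, ih, Finset.sum_range_succ]; ring

variable [Nonempty A]

theorem abs_critic_le (h : IsACPath r γ α N e sc sa) (hN : 0 < (N : ℝ)) (hαN : α / N ≤ 1)
    (hr : ∀ x a, 0 ≤ r x a ∧ r x a ≤ 1) (hγ : 0 < γ) (hα : 0 < α) (hR : 1 + γ * R ≤ R)
    (h0 : ∀ i, |(e 0).critic i| ≤ R) (k : ℕ) : ∀ i, |(e k).critic i| ≤ R := by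
  induction k with
  | zero => exact h0
  | succ k ih =>
    intro i
    rw [h.critic_succ]
    refine abs_critic_add_criticIncr_le hr hγ hα hR (by positivity) ?_ ih _ _ _
    rwa [mul_comm, ← div_eq_mul_inv]

theorem abs_actor_le (h : IsACPath r γ α N e sc sa) (hN : 0 < (N : ℝ))
    (hc : ∀ k i, |(e k).critic i| ≤ R) {R₀ : ℝ} (h0 : ∀ i, |(e 0).actor i| ≤ R₀) (k : ℕ)
    (i : X × A) : |(e k).actor i| ≤ R₀ + k / N * R := by
  rw [h.actor_eq_add_sum]
  refine (abs_add_le _ _).trans (add_le_add (h0 i) ?_)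
  rw [abs_mul, abs_of_pos (inv_pos.2 hN)]
  calc _ ≤ (N : ℝ)⁻¹ * ∑ j ∈ Finset.range k, R := by
        refine mul_le_mul_of_nonneg_left ((Finset.abs_sum_le_sum_abs _ _).trans
          (Finset.sum_le_sum fun j _ => abs_actorIncr_le (hc j) _ _ _)) (by positivity)
    _ = k / N * R := by rw [Finset.sum_const, Finset.card_range, nsmul_eq_mul]; ring

theorem dist_succ_le [Fintype X] (h : IsACPath r γ α N e sc sa) (hN : 0 < (N : ℝ))
    (hr : ∀ x a, 0 ≤ r x a ∧ r x a ≤ 1) (hγ : 0 < γ) (hα : 0 < α) (hR : 1 + γ * R ≤ R)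
    (hc : ∀ k i, |(e k).critic i| ≤ R) (hR0 : 0 ≤ R) (k : ℕ) :
    dist (e (k + 1)) (e k) ≤ (1 + α * (2 * R) + R) / N := by
  have hi : 0 < (N : ℝ)⁻¹ := inv_pos.2 hN
  have h2 : 0 ≤ α * (2 * R) := by positivity
  rw [div_eq_inv_mul]
  refine dist_le_of_abs_sub_le (by positivity) ?_ (fun i => ?_) fun i => ?_
  · rw [h.time, h.time, NNReal.dist_eq]
    push_cast
    rw [show ((k : ℝ) + 1) / N - k / N = (N : ℝ)⁻¹ by ring, abs_of_pos hi]
    nlinarith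
  · rw [h.actor_succ, add_sub_cancel_left, abs_mul, abs_of_pos hi]
    refine mul_le_mul_of_nonneg_left ?_ hi.le
    linarith [abs_actorIncr_le (hc k) i (sa k) (sa (k + 1))]
  · rw [h.critic_succ, add_sub_cancel_left, abs_mul, abs_of_pos hi]
    refine mul_le_mul_of_nonneg_left ?_ hi.le
    linarith [abs_criticIncr_le hr hγ hα hR (hc k) i (sc k) (sc (k + 1))]

theorem measurable [Fintype X] {Ω : Type*} {mΩ : MeasurableSpace Ω} {F : Filtration ℕ mΩ}
    [MeasurableSpace X] [MeasurableSingletonClass X]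
    [MeasurableSpace A] [MeasurableSingletonClass A]
    {e : ℕ → Ω → ACState X A} {sc sa : ℕ → Ω → X × A}
    (h : ∀ ω, IsACPath r γ α N (fun k => e k ω) (fun k => sc k ω) fun k => sa k ω)
    {e₀ : ACState X A} (h0 : ∀ ω, e 0 ω = e₀)
    (hsc : ∀ k, Measurable[F k] (sc k)) (hsa : ∀ k, Measurable[F k] (sa k)) (k : ℕ) :
    Measurable[F k] (e k) := by
  induction k with
  | zero =>
    rw [show e 0 = fun _ => e₀ from funext h0]
    exact measurable_const
  | succ k ih =>
    have ih' := ih.mono (F.mono k.le_succ) le_rfl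
    have key : ∀ (u : ACState X A → X × A → X × A → ℝ) (s : ℕ → Ω → X × A),
        (∀ s s', Continuous fun e => u e s s') → (∀ k, Measurable[F k] (s k)) →
        Measurable[F (k + 1)] fun ω => u (e k ω) (s k ω) (s (k + 1) ω) := by
      intro u s hu hs
      exact measurable_apply_of_countable (f := fun e (q : (X × A) × (X × A)) => u e q.1 q.2)
        (fun q => (hu _ _).measurable) ih'
        (((hs k).mono (F.mono k.le_succ) le_rfl).prodMk (hs (k + 1)))
    have hlin : Measurable fun q : ℝ × ℝ => q.1 + (N : ℝ)⁻¹ * q.2 := by fun_prop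
    have ha : ∀ i, Measurable[F (k + 1)] fun ω => (e k ω).actor i := fun i =>
      (measurable_pi_apply i.2).comp ((measurable_pi_apply i.1).comp ih'.snd.fst)
    have hc : ∀ i, Measurable[F (k + 1)] fun ω => (e k ω).critic i := fun i =>
      (continuous_critic i).measurable.comp ih'
    refine Measurable.prodMk ?_ (Measurable.prodMk ?_ ?_)
    · simp_rw [(h _).time]
      exact measurable_const
    · refine (@measurable_pi_iff _ _ _ (F (k + 1)) _ _).2 fun x =>
        (@measurable_pi_iff _ _ _ (F (k + 1)) _ _).2 fun a => ?_
      rw [show (fun ω => (e (k + 1) ω).2.1 x a) = _ from funext fun ω =>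
        (h ω).actor_succ k (x, a)]
      exact hlin.comp ((ha _).prodMk (key _ sa (continuous_actorIncr _) hsa))
    · refine (@measurable_pi_iff _ _ _ (F (k + 1)) _ _).2 fun x =>
        (@measurable_pi_iff _ _ _ (F (k + 1)) _ _).2 fun a => ?_
      rw [show (fun ω => (e (k + 1) ω).2.2 x a) = _ from funext fun ω =>
        (h ω).critic_succ k (x, a)]
      exact hlin.comp ((hc _).prodMk (key _ sc (continuous_criticIncr r γ α _) hsc))

end IsACPath

theorem eventually_abs_slope_sub_le {J : Type*} [Fintype J] {z : J → ℝ → ℝ} {v : J → NNReal → ℝ}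
    (hv : ∀ j, Continuous (v j)) (hz : ∀ j (t : NNReal), HasDerivAt (z j) (v j t) t) (T : NNReal)
    {κ : ℝ} (hκ : 0 < κ) :
    ∀ᶠ N : ℕ in atTop, ∀ k : ℕ, ((k + 1 : ℕ) : ℝ) ≤ N * T → ∀ j,
      |N * (z j (((k + 1 : ℕ) : ℝ) / N) - z j (k / N)) - v j (k / N)| ≤ κ := by
  obtain ⟨δ, hδ, h⟩ := exists_forall_abs_sub_le_of_isCompact
    (isCompact_Icc (a := (0 : NNReal)) (b := T)) v hv hκ
  filter_upwards [eventually_div_natCast_le 1 hδ] with N hN k hk j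
  obtain ⟨hN, hNδ⟩ := hN
  have hlt : (k : ℝ) / N < ((k + 1 : ℕ) : ℝ) / N := by
    gcongr
    exact k.lt_succ_self
  have hk0 : 0 ≤ (k : ℝ) / N := by positivity
  obtain ⟨c, ⟨hc1, hc2⟩, hc⟩ := exists_hasDerivAt_eq_slope (z j) (fun t => v j t.toNNReal) hlt
    (fun t ht => by
      have := hz j ⟨t, hk0.trans ht.1⟩
      exact this.continuousAt.continuousWithinAt)
    (fun t ht => by
      have := hz j ⟨t, hk0.trans ht.1.le⟩
      rwa [show (⟨t, hk0.trans ht.1.le⟩ : NNReal) = t.toNNReal from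
        (Real.toNNReal_of_nonneg _).symm, Real.coe_toNNReal _ (hk0.trans ht.1.le)] at this)
  have hstep : ((k + 1 : ℕ) : ℝ) / N - k / N = (N : ℝ)⁻¹ := by push_cast; ring
  have h1 : N * (z j (((k + 1 : ℕ) : ℝ) / N) - z j (k / N)) = v j c.toNNReal := by
    rw [hc, hstep]
    field_simp
  have hc0 := hk0.trans hc1.le
  have hkT : ((k + 1 : ℕ) : ℝ) / N ≤ T := by rwa [div_le_iff₀' hN]
  rw [h1]
  refine h j _ ⟨bot_le, ?_⟩ _ ⟨bot_le, ?_⟩ ?_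
  · exact Real.toNNReal_le_iff_le_coe.2 (hc2.le.trans hkT)
  · rw [← NNReal.coe_le_coe]
    push_cast
    exact hlt.le.trans hkT
  · rw [NNReal.dist_eq, Real.coe_toNNReal _ hc0]
    push_cast
    rw [abs_of_nonneg (sub_nonneg.2 hc1.le)]
    rw [one_div] at hNδ
    linarith

theorem eventually_abs_floor_div_sub_le {J : Type*} [Fintype J] {z : J → NNReal → ℝ}
    (hz : ∀ j, Continuous (z j)) (T : NNReal) {ε : ℝ} (hε : 0 < ε) :
    ∀ᶠ N : ℕ in atTop, ∀ t ≤ T, ∀ j, |z j (⌊(N : ℝ) * t⌋₊ / N) - z j t| ≤ ε := by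
  obtain ⟨δ, hδ, h⟩ := exists_forall_abs_sub_le_of_isCompact
    (isCompact_Icc (a := (0 : NNReal)) (b := T)) z hz hε
  filter_upwards [eventually_div_natCast_le 1 hδ] with N hN t ht j
  obtain ⟨hN, hNδ⟩ := hN
  have h1 : (⌊(N : ℝ) * t⌋₊ : ℝ) / N ≤ t := by
    rw [div_le_iff₀' hN]
    exact Nat.floor_le (by positivity)
  have h2 : (t : ℝ) - ⌊(N : ℝ) * t⌋₊ / N ≤ 1 / N := by
    have := Nat.lt_floor_add_one ((N : ℝ) * t)
    rw [sub_le_iff_le_add, ← add_div, le_div_iff₀ hN]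
    linarith
  have h3 : (⌊(N : ℝ) * t⌋₊ / N : NNReal) ≤ t := by
    rw [← NNReal.coe_le_coe]
    push_cast
    exact h1
  refine h j _ ⟨bot_le, h3.trans ht⟩ _ ⟨bot_le, ht⟩ ?_
  rw [dist_comm, NNReal.dist_eq]
  push_cast
  rw [abs_of_nonneg (sub_nonneg.2 h1)]
  linarith

open ACState in
theorem IsACPath.gauge_le {X A : Type*} [Fintype X] [Fintype A] [DecidableEq X] [DecidableEq A]
    {r : X → A → ℝ} {γ α R : ℝ} {N : ℕ} {e : ℕ → ACState X A} {sc sa : ℕ → X × A}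
    (h : IsACPath r γ α N e sc sa) (hN : 0 < (N : ℝ)) {y : NNReal → ACState X A}
    (hy : ∀ t, (y t).1 = t) (h0 : e 0 = y 0) {T : NNReal}
    (hec : ∀ k i, |(e k).critic i| ≤ R) (hyc : ∀ t ≤ T, ∀ i, |(y t).critic i| ≤ R)
    {da dc : X × A → ACState X A → ℝ} {L κ : ℝ} (hL : 0 ≤ L) (hκ : 0 ≤ κ)
    (hda : ∀ i e e', Related R e e' → |da i e - da i e'| ≤ L * gauge e e')
    (hdc : ∀ i e e', Related R e e' → |dc i e - dc i e'| ≤ L * gauge e e')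
    (hsa : ∀ k : ℕ, ((k + 1 : ℕ) : ℝ) ≤ N * T → ∀ i,
      |N * ((y ((k + 1 : ℕ) / N)).actor i - (y (k / N)).actor i) - da i (y (k / N))| ≤ κ)
    (hsc : ∀ k : ℕ, ((k + 1 : ℕ) : ℝ) ≤ N * T → ∀ i,
      |N * ((y ((k + 1 : ℕ) / N)).critic i - (y (k / N)).critic i) - dc i (y (k / N))| ≤ κ)
    {Ga Gc : X × A → ℝ}
    (hGa : ∀ i, ∀ n : ℕ, (n : ℝ) ≤ N * T → |(N : ℝ)⁻¹ * ∑ k ∈ Finset.range n,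
      (actorIncr i (e k) (sa k) (sa (k + 1)) - da i (e k))| ≤ Ga i)
    (hGc : ∀ i, ∀ n : ℕ, (n : ℝ) ≤ N * T → |(N : ℝ)⁻¹ * ∑ k ∈ Finset.range n,
      (criticIncr r γ α i (e k) (sc k) (sc (k + 1)) - dc i (e k))| ≤ Gc i)
    {n : ℕ} (hn : (n : ℝ) ≤ N * T) :
    gauge (e n) (y (n / N)) ≤ (∑ i, Ga i + ∑ i, Gc i +
      Fintype.card ((X × A) ⊕ (X × A)) * (T * κ)) *
        Real.exp (Fintype.card ((X × A) ⊕ (X × A)) * L * T) := by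
  have hle : ∀ {k : ℕ}, k ≤ n → ((k : NNReal) / N) ≤ T := fun {k} hk => by
    rw [← NNReal.coe_le_coe]
    push_cast
    rw [div_le_iff₀' hN]
    exact le_trans (by exact_mod_cast hk) hn
  have hlt : ∀ {k : ℕ}, k < n → ((k + 1 : ℕ) : ℝ) ≤ N * T := fun {k} hk =>
    le_trans (by exact_mod_cast hk) hn
  rw [gauge_eq, show ∑ i, Ga i + ∑ i, Gc i = ∑ j, Sum.elim Ga Gc j by simp [Fintype.sum_sum_type]]
  refine sum_abs_sub_le_exp_mul
    (y := fun k => Sum.elim (e k).actor (e k).critic)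
    (z := fun k => Sum.elim (y (k / N)).actor (y (k / N)).critic)
    (β := fun k => Sum.elim (da · (e k)) (dc · (e k)))
    (β' := fun k => Sum.elim (da · (y (k / N))) (dc · (y (k / N))))
    (ρ := fun k => Sum.elim
      (fun i => N * ((y ((k + 1 : ℕ) / N)).actor i - (y (k / N)).actor i) - da i (y (k / N)))
      fun i => N * ((y ((k + 1 : ℕ) / N)).critic i - (y (k / N)).critic i) - dc i (y (k / N)))
    (M := fun n => Sum.elim
      (fun i => (N : ℝ)⁻¹ * ∑ k ∈ Finset.range n,
        (actorIncr i (e k) (sa k) (sa (k + 1)) - da i (e k)))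
      fun i => (N : ℝ)⁻¹ * ∑ k ∈ Finset.range n,
        (criticIncr r γ α i (e k) (sc k) (sc (k + 1)) - dc i (e k)))
    (G := Sum.elim Ga Gc) (h := (N : ℝ)⁻¹) (inv_pos.2 hN).le hL hκ n ?_ ?_ ?_ ?_ ?_ ?_
  · rwa [← div_eq_mul_inv, div_le_iff₀' hN]
  · rintro k (i | i)
    · simp only [Sum.elim_inl, Nat.cast_zero, zero_div, ← h0]
      rw [h.actor_eq_add_sum, Finset.sum_sub_distrib]
      ring
    · simp only [Sum.elim_inr, Nat.cast_zero, zero_div, ← h0]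
      rw [h.critic_eq_add_sum, Finset.sum_sub_distrib]
      ring
  · rintro k - (i | i)
    · simp only [Sum.elim_inl]
      field_simp
      ring
    · simp only [Sum.elim_inr]
      field_simp
      ring
  · rintro k hk (i | i)
    · exact hsa k (hlt hk) i
    · exact hsc k (hlt hk) i
  · rintro k hk (i | i)
    · exact hGa i k (le_trans (by exact_mod_cast hk) hn)
    · exact hGc i k (le_trans (by exact_mod_cast hk) hn)
  · rintro k hk (i | i)
    all_goals
      have hrel : Related R (e k) (y (k / N)) :=
        ⟨by rw [h.time, hy], hec k, hyc _ (hle hk.le)⟩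
    · simpa [gauge_eq] using hda i _ _ hrel
    · simpa [gauge_eq] using hdc i _ _ hrel

open ACState

theorem integral_sum_add_sum_add_mul_le {Ω I : Type*} [Fintype I] {mΩ : MeasurableSpace Ω}
    {P : Measure Ω} [IsProbabilityMeasure P] {f g : I → Ω → ℝ} {κ C : ℝ}
    (hf : ∀ i, Integrable (f i) P) (hg : ∀ i, Integrable (g i) P)
    (hfκ : ∀ i, ∫ ω, f i ω ∂P ≤ κ) (hgκ : ∀ i, ∫ ω, g i ω ∂P ≤ κ) (b : ℝ) (hC : 0 ≤ C) :
    Integrable (fun ω => (∑ i, f i ω + ∑ i, g i ω + b) * C) P ∧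
      ∫ ω, (∑ i, f i ω + ∑ i, g i ω + b) * C ∂P ≤
        (Fintype.card I * κ + Fintype.card I * κ + b) * C := by
  have hF : Integrable (fun ω => ∑ i, f i ω) P := integrable_finsetSum _ fun i _ => hf i
  have hG : Integrable (fun ω => ∑ i, g i ω) P := integrable_finsetSum _ fun i _ => hg i
  have hFG : Integrable (fun ω => ∑ i, f i ω + ∑ i, g i ω) P := hF.add hG
  have hsum : ∀ {h : I → Ω → ℝ}, (∀ i, Integrable (h i) P) → (∀ i, ∫ ω, h i ω ∂P ≤ κ) →
      ∫ ω, ∑ i, h i ω ∂P ≤ Fintype.card I * κ := fun {h} h1 h2 => by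
    rw [integral_finsetSum _ fun i _ => h1 i]
    refine (Finset.sum_le_sum fun i _ => h2 i).trans (le_of_eq ?_)
    rw [Finset.sum_const, nsmul_eq_mul, Finset.card_univ]
  refine ⟨(hFG.add (integrable_const b)).mul_const C, ?_⟩
  rw [integral_mul_const, integral_add hFG (integrable_const b), integral_add hF hG,
    integral_const, probReal_univ, one_smul]
  gcongr
  · exact hsum hf hfκ
  · exact hsum hg hgκ

set_option maxHeartbeats 1000000 in
theorem eventually_exists_integrable_bound_gauge {X A : Type*} [Fintype X] [Fintype A]
    [Nonempty X] [Nonempty A] [DecidableEq X] [DecidableEq A]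
    {p q : X → A → X → ℝ} {r : X → A → ℝ} {γ α R : ℝ}
    (hp1 : ∀ x a, ∑ x', p x a x' = 1) (hq1 : ∀ x a, ∑ x', q x a x' = 1)
    (hr : ∀ x a, 0 ≤ r x a ∧ r x a ≤ 1) (hγ : 0 < γ) (hα : 0 < α)
    {sigsta pista : (X → A → ℝ) → X × A → ℝ}
    (hsig : ∀ e : ACState X A, IsStationaryDist (criticKer q e.actorPol) (sigsta e.actorPol))
    (hsigLip : ∃ L : ℝ, ∀ f f' : X → A → ℝ,
      ∑ ξ : X × A, |sigsta f ξ - sigsta f' ξ| ≤ L * ∑ x, ∑ a, |f x a - f' x a|)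
    (hergA : ∀ e : ACState X A, ∃ n, 0 < n ∧
      ∀ ξ ξ' : X × A, 0 < kpow (criticKer q e.actorPol) n ξ ξ')
    (hpi : ∀ e : ACState X A, IsStationaryDist (criticKer p e.criticPol) (pista e.criticPol))
    (hpiLip : ∃ L : ℝ, ∀ f f' : X → A → ℝ,
      ∑ ξ : X × A, |pista f ξ - pista f' ξ| ≤ L * ∑ x, ∑ a, |f x a - f' x a|)
    (hergC : ∀ e : ACState X A, ∃ n, 0 < n ∧
      ∀ ξ ξ' : X × A, 0 < kpow (criticKer p e.criticPol) n ξ ξ')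
    {Ω : Type*} [mΩ : MeasurableSpace Ω] (P : Measure Ω) [IsProbabilityMeasure P]
    [MeasurableSpace X] [MeasurableSingletonClass X]
    [MeasurableSpace A] [MeasurableSingletonClass A]
    (F : ℕ → Filtration ℕ mΩ) {e : ℕ → ℕ → Ω → ACState X A} {sc sa : ℕ → ℕ → Ω → X × A}
    (he : ∀ N ω, IsACPath r γ α N (fun k => e N k ω) (fun k => sc N k ω) fun k => sa N k ω)
    {y : NNReal → ACState X A} (h0 : ∀ N ω, e N 0 ω = y 0)
    (hsc : ∀ N k, Measurable[F N k] (sc N k)) (hsa : ∀ N k, Measurable[F N k] (sa N k))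
    (hcondc : ∀ N k s, P[fun ω => if sc N (k + 1) ω = s then (1 : ℝ) else 0 | F N k] =ᵐ[P]
      fun ω => criticKer p (e N (k + 1) ω).criticPol (sc N k ω) s)
    (hconda : ∀ N k s, P[fun ω => if sa N (k + 1) ω = s then (1 : ℝ) else 0 | F N k] =ᵐ[P]
      fun ω => criticKer q (e N (k + 1) ω).actorPol (sa N k ω) s)
    (hy : ∀ t, (y t).1 = t) (hycont : Continuous y) {T : NNReal} (hT : 0 < T)
    (hR : 1 + γ * R ≤ R) (hR0 : 0 ≤ R) (hyR : ∀ t ≤ T, ∀ i, |(y t).critic i| ≤ R)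
    {za zc : X × A → ℝ → ℝ} (hza : ∀ i (t : NNReal), (y t).actor i = za i t)
    (hzc : ∀ i (t : NNReal), (y t).critic i = zc i t)
    (hodea : ∀ i (t : NNReal), HasDerivAt (za i) (actorDrift sigsta i (y t)) t)
    (hodec : ∀ i (t : NNReal), HasDerivAt (zc i) (criticDrift p r γ α pista i (y t)) t)
    {ε : ℝ} (hε : 0 < ε) :
    ∀ᶠ N : ℕ in atTop, ∃ G : Ω → ℝ, Integrable G P ∧ ∫ ω, G ω ∂P ≤ ε ∧
      ∀ ω, ∀ n : ℕ, (n : ℝ) ≤ N * T → gauge (e N n ω) (y (n / N)) ≤ G ω := by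
  have hT' : (0 : ℝ) < T := hT
  obtain ⟨La, hLa, hda⟩ := IsBddLip.exists_common gauge_nonneg
    (isBddLip_actorDrift hR0 (fun e => (hsig e).abs_le_one) hsigLip)
  obtain ⟨Lc, hLc, hdc⟩ := IsBddLip.exists_common gauge_nonneg
    (isBddLip_criticDrift hR0 p r γ α (fun e => (hpi e).abs_le_one) hpiLip)
  have hsigc : ∀ s, Continuous fun f => sigsta f s := continuous_apply_of_sum_abs_sub_le hsigLip
  have hpic : ∀ s, Continuous fun f => pista f s := continuous_apply_of_sum_abs_sub_le hpiLip
  set c : ℝ := ((Fintype.card ((X × A) ⊕ (X × A)) : ℕ) : ℝ)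
  set m : ℝ := ((Fintype.card (X × A) : ℕ) : ℝ)
  set C : ℝ := Real.exp (c * (La + Lc) * T)
  have hC0 : 0 < C := Real.exp_pos _
  set κ : ℝ := ε / ((m + m + c * T) * C + 1)
  have hden : 0 < (m + m + c * T) * C + 1 := by positivity
  have hκ0 : 0 < κ := by positivity
  obtain ⟨R₀, hR₀⟩ : ∃ R₀ : ℝ, ∀ i, |(y 0).actor i| ≤ R₀ :=
    ⟨∑ i, |(y 0).actor i|, fun i => Finset.single_le_sum (f := fun i => |(y 0).actor i|)
      (fun _ _ => abs_nonneg _) (Finset.mem_univ i)⟩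
  have hR₀0 : 0 ≤ R₀ := (abs_nonneg _).trans (hR₀ (Classical.arbitrary _))
  have hem : ∀ N k, Measurable[F N k] (e N k) := fun N k =>
    IsACPath.measurable (he N) (h0 N) (hsc N) (hsa N) k
  have hbd : ∀ᶠ N : ℕ in atTop, 0 < (N : ℝ) ∧ ∀ ω k i, |(e N k ω).critic i| ≤ R := by
    filter_upwards [eventually_div_natCast_le α one_pos] with N hN
    refine ⟨hN.1, fun ω k i => (he N ω).abs_critic_le hN.1 hN.2 hr hγ hα hR ?_ k i⟩
    intro i
    rw [h0]
    exact hyR 0 bot_le i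
  have hD := isCompact_setOf_abs_le (X := X) (A := A) T (R₀ + T * R) R
  have heD : ∀ᶠ N : ℕ in atTop, ∀ k : ℕ, (k : ℝ) ≤ N * T → ∀ ω, e N k ω ∈
      {e : ACState X A | e.1 ≤ T ∧ (∀ i, |e.actor i| ≤ R₀ + T * R) ∧ ∀ i, |e.critic i| ≤ R} := by
    filter_upwards [hbd] with N hN k hk ω
    have hkT : (k : ℝ) / N ≤ T := by rwa [div_le_iff₀' hN.1]
    refine ⟨?_, fun i => ?_, hN.2 ω k⟩
    · rw [(he N ω).time, ← NNReal.coe_le_coe]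
      push_cast
      exact hkT
    · refine ((he N ω).abs_actor_le hN.1 (hN.2 ω) (R₀ := R₀) ?_ k i).trans ?_
      · intro i
        rw [h0]
        exact hR₀ i
      · gcongr
  have hstep : ∀ δ > 0, ∀ᶠ N : ℕ in atTop, ∀ k : ℕ, ((k + 1 : ℕ) : ℝ) ≤ N * T →
      ∀ ω, dist (e N (k + 1) ω) (e N k ω) ≤ δ := by
    intro δ hδ
    filter_upwards [hbd, eventually_div_natCast_le (1 + α * (2 * R) + R) hδ] with N hN hN' k _ ω
    exact ((he N ω).dist_succ_le hN.1 hr hγ hα hR (hN.2 ω) hR0 k).trans hN'.2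
  have hker : ∀ (q : X → A → X → ℝ) (pol : ACState X A → X → A → ℝ), Continuous pol →
      ∀ s s', Continuous fun e => criticKer q (pol e) s s' := fun q pol hpol s s' =>
    continuous_const.mul ((continuous_apply _).comp ((continuous_apply _).comp hpol))
  have hA := eventually_all.2 fun i => eventually_exists_integrable_bound_average P
    (fun e => criticKer q e.actorPol) (actorIncr i) (fun e => sigsta e.actorPol)
    (actorDrift sigsta i) (hker q actorPol continuous_actorPol)
    (fun s => (hsigc s).comp continuous_actorPol) (continuous_actorIncr i)
    (fun e s => sum_criticKer hq1 e.isPolicy_actorPol s) hsig hergA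
    (fun e => actorDrift_eq_sum hq1 i e (hsig e)) F e sa hem hsa hconda hD hT' heD hstep hκ0
  have hB := eventually_all.2 fun i => eventually_exists_integrable_bound_average P
    (fun e => criticKer p e.criticPol) (criticIncr r γ α i) (fun e => pista e.criticPol)
    (criticDrift p r γ α pista i) (hker p criticPol continuous_criticPol)
    (fun s => (hpic s).comp continuous_criticPol) (continuous_criticIncr r γ α i)
    (fun e s => sum_criticKer hp1 e.isPolicy_criticPol s) hpi hergC
    (fun e => criticDrift_eq_sum hp1 r γ α pista i e) F e sc hem hsc hcondc hD hT' heD hstep hκ0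
  have hSA := eventually_abs_slope_sub_le
    (fun i => (continuous_actorDrift hsigc i).comp hycont) hodea T hκ0
  have hSC := eventually_abs_slope_sub_le
    (fun i => (continuous_criticDrift (p := p) (r := r) (γ := γ) (α := α) hpic i).comp hycont)
    hodec T hκ0
  filter_upwards [hbd, hA, hB, hSA, hSC] with N hN hA hB hSA hSC
  choose Ga hGa hGa' hGa'' using hA
  choose Gc hGc hGc' hGc'' using hB
  obtain ⟨hint, hle⟩ := integral_sum_add_sum_add_mul_le hGa hGc hGa' hGc' (c * (T * κ)) hC0.le
  refine ⟨fun ω => (∑ i, Ga i ω + ∑ i, Gc i ω + c * (T * κ)) * C, hint, hle.trans ?_,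
    fun ω n hn => ?_⟩
  · calc (m * κ + m * κ + c * (T * κ)) * C = ((m + m + c * T) * C) * κ := by ring
      _ ≤ ((m + m + c * T) * C + 1) * κ := by nlinarith
      _ = ε := mul_div_cancel₀ _ hden.ne'
  · refine (he N ω).gauge_le hN.1 hy (h0 N ω) (hN.2 ω) hyR (add_nonneg hLa hLc) hκ0.le
      (fun i e e' h => (hda i e e' h).trans ?_) (fun i e e' h => (hdc i e e' h).trans ?_)
      (fun k hk i => ?_) (fun k hk i => ?_) (fun i => hGa'' i ω) (fun i => hGc'' i ω) hn
    · nlinarith [gauge_nonneg e e', mul_nonneg hLc (gauge_nonneg e e')]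
    · nlinarith [gauge_nonneg e e', mul_nonneg hLa (gauge_nonneg e e')]
    · simpa only [hza, NNReal.coe_div, NNReal.coe_natCast, Function.comp_apply] using hSA k hk i
    · simpa only [hzc, NNReal.coe_div, NNReal.coe_natCast, Function.comp_apply] using hSC k hk i

theorem tendsto_integral_iSup_gauge {X A Ω : Type*} [Fintype X] [Fintype A]
    {mΩ : MeasurableSpace Ω} {P : Measure Ω} [IsProbabilityMeasure P]
    {e : ℕ → ℕ → Ω → ACState X A} {y : NNReal → ACState X A} (hycont : Continuous y) (T : NNReal)
    (h : ∀ ε > 0, ∀ᶠ N : ℕ in atTop, ∃ G : Ω → ℝ, Integrable G P ∧ ∫ ω, G ω ∂P ≤ ε ∧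
      ∀ ω, ∀ n : ℕ, (n : ℝ) ≤ N * T → gauge (e N n ω) (y (n / N)) ≤ G ω) :
    Tendsto (fun N : ℕ => ∫ ω, (⨆ t : Set.Icc (0 : ℝ) T,
      gauge (e N ⌊(N : ℝ) * (t : ℝ)⌋₊ ω) (y ⟨t, t.2.1⟩)) ∂P) atTop (nhds 0) := by
  rw [Metric.tendsto_nhds]
  intro ε hε
  set c : ℝ := ((Fintype.card ((X × A) ⊕ (X × A)) : ℕ) : ℝ)
  have hε' : 0 < ε / 4 / (c + 1) := by positivity
  have hcoord : ∀ j, Continuous fun t => Sum.elim (y t).actor (y t).critic j := by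
    rintro (i | i)
    · exact (continuous_apply i.2).comp ((continuous_apply i.1).comp
        (continuous_fst.comp (continuous_snd.comp hycont)))
    · exact (continuous_critic i).comp hycont
  filter_upwards [h (ε / 4) (by positivity), eventually_abs_floor_div_sub_le hcoord T hε']
    with N ⟨G, hGi, hGε, hG⟩ hfloor
  have hbound : ∀ ω, (⨆ t : Set.Icc (0 : ℝ) T,
      gauge (e N ⌊(N : ℝ) * (t : ℝ)⌋₊ ω) (y ⟨t, t.2.1⟩)) ≤ G ω + ε / 4 := by
    intro ω
    refine Real.iSup_le (fun t => ?_) ?_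
    · have h1 := hG ω ⌊(N : ℝ) * (t : ℝ)⌋₊ ((Nat.floor_le (mul_nonneg N.cast_nonneg t.2.1)).trans
        (mul_le_mul_of_nonneg_left t.2.2 N.cast_nonneg))
      have h2 : gauge (y (⌊(N : ℝ) * (t : ℝ)⌋₊ / N)) (y ⟨t, t.2.1⟩) ≤ ε / 4 := by
        rw [gauge_eq]
        calc _ ≤ ∑ _j : (X × A) ⊕ (X × A), ε / 4 / (c + 1) :=
              Finset.sum_le_sum fun j _ => hfloor ⟨t, t.2.1⟩ t.2.2 j
          _ = c * (ε / 4 / (c + 1)) := by rw [Finset.sum_const, nsmul_eq_mul, Finset.card_univ]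
          _ ≤ (c + 1) * (ε / 4 / (c + 1)) := by nlinarith
          _ = ε / 4 := mul_div_cancel₀ _ (by positivity)
      exact (gauge_triangle _ _ _).trans (add_le_add h1 h2)
    · have := (gauge_nonneg _ _).trans (hG ω 0 (by rw [Nat.cast_zero]; positivity))
      linarith
  have hnonneg : ∀ ω, 0 ≤ ⨆ t : Set.Icc (0 : ℝ) T,
      gauge (e N ⌊(N : ℝ) * (t : ℝ)⌋₊ ω) (y ⟨t, t.2.1⟩) := fun ω =>
    Real.iSup_nonneg fun t => gauge_nonneg _ _
  have hadd : Integrable (fun ω => G ω + ε / 4) P := hGi.add (integrable_const _)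
  have hle := integral_mono_of_nonneg (ae_of_all P hnonneg) hadd (ae_of_all P hbound)
  rw [integral_add hGi (integrable_const _), integral_const, probReal_univ, one_smul] at hle
  rw [Real.dist_0_eq_abs, abs_of_nonneg (integral_nonneg hnonneg)]
  linarith

theorem actor_critic_ode_limit
    {X A : Type*} [Fintype X] [Fintype A] [Nonempty X] [Nonempty A]
    [DecidableEq X] [DecidableEq A]
    (p : X → A → X → ℝ) (μ : X → ℝ) (r : X → A → ℝ) (γ α : ℝ)
    (hp0 : ∀ x a x', 0 ≤ p x a x') (hp1 : ∀ x a, ∑ x', p x a x' = 1)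
    (hμ0 : ∀ x, 0 ≤ μ x) (hμ1 : ∑ x, μ x = 1)
    (hr : ∀ x a, 0 ≤ r x a ∧ r x a ≤ 1) (hγ : 0 < γ ∧ γ < 1) (hα : 0 < α)
    (sigsta : (X → A → ℝ) → X × A → ℝ)
    (hsig : ∀ θ : X → A → ℝ,
      IsStationaryDist (actorKer γ p μ (softmaxPol θ)) (sigsta (softmaxPol θ)))
    (hsigLip : ∃ L : ℝ, ∀ f f' : X → A → ℝ,
      ∑ ξ : X × A, |sigsta f ξ - sigsta f' ξ| ≤ L * ∑ x, ∑ a, |f x a - f' x a|)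
    (hergA : ∀ θ : X → A → ℝ, ∃ n, 0 < n ∧
      ∀ ξ ξ' : X × A, 0 < kpow (actorKer γ p μ (softmaxPol θ)) n ξ ξ')
    (pista : (X → A → ℝ) → X × A → ℝ)
    (hpi : ∀ (η : ℝ) (θ : X → A → ℝ), 0 ≤ η → η < 1 →
      IsStationaryDist (criticKer p (explorePol η θ)) (pista (explorePol η θ)))
    (hpiLip : ∃ L : ℝ, ∀ f f' : X → A → ℝ,
      ∑ ξ : X × A, |pista f ξ - pista f' ξ| ≤ L * ∑ x, ∑ a, |f x a - f' x a|)
    (hergC : ∀ (η : ℝ) (θ : X → A → ℝ), 0 ≤ η → η < 1 → ∃ n, 0 < n ∧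
      ∀ ξ ξ' : X × A, 0 < kpow (criticKer p (explorePol η θ)) n ξ ξ')
    {Ω : Type*} [mΩ : MeasurableSpace Ω] (P : Measure Ω) [IsProbabilityMeasure P]
    [MeasurableSpace X] [MeasurableSingletonClass X]
    [MeasurableSpace A] [MeasurableSingletonClass A]
    (Q0 θ0 : X → A → ℝ)
    (F : ℕ → MeasureTheory.Filtration ℕ mΩ)
    (xc : ℕ → ℕ → Ω → X) (ac : ℕ → ℕ → Ω → A)
    (xa : ℕ → ℕ → Ω → X) (aa : ℕ → ℕ → Ω → A)
    (Q θ : ℕ → ℕ → Ω → X → A → ℝ)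
    (hQinit : ∀ N ω, Q N 0 ω = Q0) (hθinit : ∀ N ω, θ N 0 ω = θ0)
    (hQrec : ∀ N k ω x a, Q N (k + 1) ω x a = Q N k ω x a + (α / N) *
      (r (xc N k ω) (ac N k ω) + γ * (∑ a'', Q N k ω (xc N (k + 1) ω) a'' *
          explorePol (etaN N k) (θ N k ω) (xc N (k + 1) ω) a'')
        - Q N k ω (xc N k ω) (ac N k ω)) *
      (if xc N k ω = x ∧ ac N k ω = a then 1 else 0))
    (hθrec : ∀ N k ω x a, θ N (k + 1) ω x a = θ N k ω x a + (zetaN N k / N) *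
      Q N k ω (xa N k ω) (aa N k ω) * (if xa N k ω = x then 1 else 0) *
      ((if aa N k ω = a then 1 else 0) - softmaxPol (θ N k ω) (xa N k ω) a))
    (hadaptc : ∀ N k, Measurable[(F N) k] fun ω => (xc N k ω, ac N k ω))
    (hadapta : ∀ N k, Measurable[(F N) k] fun ω => (xa N k ω, aa N k ω))
    (hMarkovC : ∀ N k (ξ' : X × A),
      (P[(fun ω => if (xc N (k + 1) ω, ac N (k + 1) ω) = ξ' then (1 : ℝ) else 0)|(F N) k])
        =ᵐ[P] fun ω => p (xc N k ω) (ac N k ω) ξ'.1 *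
          explorePol (etaN N (k + 1)) (θ N (k + 1) ω) ξ'.1 ξ'.2)
    (hMarkovA : ∀ N k (ξ' : X × A),
      (P[(fun ω => if (xa N (k + 1) ω, aa N (k + 1) ω) = ξ' then (1 : ℝ) else 0)|(F N) k])
        =ᵐ[P] fun ω => ptilde γ p μ (xa N k ω) (aa N k ω) ξ'.1 *
          softmaxPol (θ N (k + 1) ω) ξ'.1 ξ'.2)
    (Qb θb : ℝ → X → A → ℝ)
    (hQode : ∀ t, 0 ≤ t → ∀ x a, HasDerivAt (fun s => Qb s x a)
      (α * pista (explorePol (etaT t) (θb t)) (x, a) *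
        (r x a + γ * (∑ z, ∑ a'', Qb t z a'' * explorePol (etaT t) (θb t) z a'' * p x a z)
          - Qb t x a)) t)
    (hθode : ∀ t, 0 ≤ t → ∀ x a, HasDerivAt (fun s => θb s x a)
      (zetaT t * sigsta (softmaxPol (θb t)) (x, a) *
        (Qb t x a - ∑ a', Qb t x a' * softmaxPol (θb t) x a')) t)
    (hQbinit : ∀ x a, Qb 0 x a = Q0 x a) (hθbinit : ∀ x a, θb 0 x a = θ0 x a)
    (T : ℝ) (hT : 0 < T) :
    Tendsto (fun N : ℕ => ∫ ω,
        (⨆ t : Set.Icc (0 : ℝ) T,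
          ((∑ x, ∑ a, |θ N ⌊(N : ℝ) * (t : ℝ)⌋₊ ω x a - θb (t : ℝ) x a|) +
            ∑ x, ∑ a, |Q N ⌊(N : ℝ) * (t : ℝ)⌋₊ ω x a - Qb (t : ℝ) x a|)) ∂P)
      atTop (nhds 0) := by
  obtain ⟨hγ0, hγ1⟩ := hγ
  have hq1 : ∀ x a, ∑ x', ptilde γ p μ x a x' = 1 := fun x a => by
    simp only [ptilde, Finset.sum_add_distrib, ← Finset.mul_sum, hp1, hμ1]
    ring
  have hη : ∀ N k : ℕ, etaT (((k : NNReal) / (N : NNReal) : NNReal) : ℝ) = etaN N k :=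
    fun N k => by simp [etaT, etaN]
  have hζ : ∀ N k : ℕ, zetaT (((k : NNReal) / (N : NNReal) : NNReal) : ℝ) = zetaN N k :=
    fun N k => by simp [zetaT, zetaN]
  let e : ℕ → ℕ → Ω → ACState X A := fun N k ω => (k / N, θ N k ω, Q N k ω)
  let y : NNReal → ACState X A := fun t => (t, θb t, Qb t)
  have he : ∀ N ω, IsACPath r γ α N (fun k => e N k ω) (fun k => (xc N k ω, ac N k ω))
      fun k => (xa N k ω, aa N k ω) := fun N ω => by
    refine ⟨fun k => rfl, fun k i => ?_, fun k i => ?_⟩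
    · simp only [e, critic, criticIncr, criticPol, hη, hQrec]
      ring
    · simp only [e, critic, actor, actorIncr, actorPol, hζ, hθrec]
      ring
  have hycont : Continuous y := by
    refine continuous_id.prodMk (Continuous.prodMk ?_ ?_) <;>
      refine continuous_pi fun x => continuous_pi fun a => continuous_iff_continuousAt.2 fun t => ?_
    · exact ContinuousAt.comp (f := fun t : NNReal => (t : ℝ)) (g := fun s => θb s x a)
        (hθode t t.2 x a).continuousAt NNReal.continuous_coe.continuousAt
    · exact ContinuousAt.comp (f := fun t : NNReal => (t : ℝ)) (g := fun s => Qb s x a)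
        (hQode t t.2 x a).continuousAt NNReal.continuous_coe.continuousAt
  have h0 : ∀ N ω, e N 0 ω = y 0 := fun N ω => by
    simp only [e, y, hQinit, hθinit, Nat.cast_zero, zero_div, NNReal.coe_zero]
    rw [show θb 0 = θ0 from funext fun x => funext (hθbinit x),
      show Qb 0 = Q0 from funext fun x => funext (hQbinit x)]
  obtain ⟨C, hC0, hC⟩ := exists_forall_abs_le_of_isCompact
    (isCompact_Icc (a := (0 : NNReal)) (b := T.toNNReal)) (fun i t => (y t).critic i)
    fun i => (continuous_critic i).comp hycont
  have hγ' : 0 < 1 - γ := sub_pos.2 hγ1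
  have hR : 1 + γ * (C + (1 - γ)⁻¹) ≤ C + (1 - γ)⁻¹ := by
    have : (1 - γ) * (1 - γ)⁻¹ = 1 := mul_inv_cancel₀ hγ'.ne'
    nlinarith
  have key := tendsto_integral_iSup_gauge (P := P) (e := e) hycont T.toNNReal fun ε hε =>
    eventually_exists_integrable_bound_gauge hp1 hq1 hr hγ0 hα
      (fun e => hsig e.2.1) hsigLip (fun e => hergA e.2.1)
      (fun e => by
        obtain ⟨η, θ', h1, h2, h3⟩ := exists_explorePol_etaT_eq e.1 e.2.1
        rw [criticPol, h3]
        exact hpi η θ' h1 h2) hpiLip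
      (fun e => by
        obtain ⟨η, θ', h1, h2, h3⟩ := exists_explorePol_etaT_eq e.1 e.2.1
        rw [criticPol, h3]
        exact hergC η θ' h1 h2)
      P F he h0 hadaptc hadapta
      (fun N k s => by
        simpa only [criticKer, criticPol, e, hη] using hMarkovC N k s)
      (fun N k s => hMarkovA N k s) (fun t => rfl) hycont (Real.toNNReal_pos.2 hT)
      (R := C + (1 - γ)⁻¹) hR (by positivity)
      (fun t ht i => (hC i t ⟨bot_le, ht⟩).trans (le_add_of_nonneg_right (by positivity)))
      (za := fun i s => θb s i.1 i.2) (zc := fun i s => Qb s i.1 i.2) (fun i t => rfl)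
      (fun i t => rfl) (fun i t => hθode t t.2 i.1 i.2) (fun i t => hQode t t.2 i.1 i.2) hε
  rw [Real.coe_toNNReal T hT.le] at key
  exact key
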